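/- For every real number α with 1 < α < 2, there exists a C^∞ μ-preserving diffeomorphism T of the torus T² such that the set B_α of all generic points of T for the Lebesgue measure μ satisfies α − 1 ≤ dim_H(B_α) ≤ α and μ(B_α) = 0, where dim_H denotes Hausdorff dimension. -/

import Mathlib

open MeasureTheory Filter Topology
open scoped ENNReal
noncomputable section

abbrev Torus2 := UnitAddCircle × UnitAddCircle

/-- Canonical projection `ℝ² → 𝕋²`. -/
def torusProj : ℝ × ℝ → Torus2 := fun p => ((p.1 : UnitAddCircle), (p.2 : UnitAddCircle))

/-- `F : ℝ² → ℝ²` is a lift of `f : 𝕋² → 𝕋²`. -/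
def IsLift (F : ℝ × ℝ → ℝ × ℝ) (f : Torus2 → Torus2) : Prop :=
  ∀ p : ℝ × ℝ, torusProj (F p) = f (torusProj p)

/-- `F` commutes with integer translations. -/
def IntEquivariant (F : ℝ × ℝ → ℝ × ℝ) : Prop :=
  ∀ p : ℝ × ℝ, ∀ m : ℤ × ℤ, F (p + ((m.1 : ℝ), (m.2 : ℝ))) = F p + ((m.1 : ℝ), (m.2 : ℝ))

/-- A C^∞ measure-preserving diffeomorphism of the torus 𝕋². -/
structure SmoothMPTorusDiffeo where
  toEquiv : Torus2 ≃ Torus2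
  lift : ℝ × ℝ → ℝ × ℝ
  liftInv : ℝ × ℝ → ℝ × ℝ
  lift_contDiff : ContDiff ℝ (⊤ : ℕ∞) lift
  liftInv_contDiff : ContDiff ℝ (⊤ : ℕ∞) liftInv
  lift_equivariant : IntEquivariant lift
  liftInv_equivariant : IntEquivariant liftInv
  lift_isLift : IsLift lift toEquiv
  liftInv_isLift : IsLift liftInv toEquiv.symm
  measurePreserving : MeasurePreserving toEquiv volume volume

/-- generic point -/
def IsGenericPt (T : Torus2 → Torus2) (ν : Measure Torus2) (x : Torus2) : Prop :=
  ∀ f : C(Torus2, ℝ),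
    Tendsto (fun N : ℕ => (N : ℝ)⁻¹ * ∑ i ∈ Finset.range N, f (T^[i] x)) atTop
      (𝓝 (∫ y, f y ∂ν))

def IsMinimalMap (T : Torus2 → Torus2) : Prop :=
  ∀ x : Torus2, Dense (Set.range fun n : ℕ => T^[n] x)

def IsWeakMixingWrt (T : Torus2 → Torus2) (ν : Measure Torus2) : Prop :=
  ∃ m : ℕ → ℕ, StrictMono m ∧ ∀ A B : Set Torus2, MeasurableSet A → MeasurableSet B →
    Tendsto (fun n => |(ν (B ∩ (T^[m n]) ⁻¹' A)).toReal - (ν A).toReal * (ν B).toReal|)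
      atTop (𝓝 0)

/-- Lift of the translation `S_t`. -/
def Slift (t : ℝ) : ℝ × ℝ → ℝ × ℝ := fun p => (p.1 + t, p.2)

open MeasureTheory Filter Topology
open scoped ENNReal
section Part1
set_option linter.unusedVariables false
set_option linter.unusedSimpArgs false

/-- biperiodic functions -/
def Biper {E : Type*} (f : ℝ × ℝ → E) : Prop :=
  ∀ p : ℝ × ℝ, ∀ m : ℤ × ℤ, f (p + ((m.1 : ℝ), (m.2 : ℝ))) = f p

/-- mean of a function over the unit square -/
def I2 (f : ℝ × ℝ → ℝ) : ℝ := ∫ y in (0:ℝ)..1, ∫ x in (0:ℝ)..1, f (x, y)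

/-- an area preserving diffeo upstairs, with inverse -/
structure Good (H K : ℝ × ℝ → ℝ × ℝ) : Prop where
  cd : ContDiff ℝ (⊤ : ℕ∞) H
  cdK : ContDiff ℝ (⊤ : ℕ∞) K
  eqv : IntEquivariant H
  eqvK : IntEquivariant K
  left : ∀ p, K (H p) = p
  right : ∀ p, H (K p) = p
  pres : ∀ f : ℝ × ℝ → ℝ, Continuous f → Biper f → I2 (fun p => f (H p)) = I2 f

lemma Biper.comp_eqv {E : Type*} {f : ℝ × ℝ → E} (hf : Biper f) {H : ℝ × ℝ → ℝ × ℝ}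
    (hH : IntEquivariant H) : Biper (fun p => f (H p)) := by
  intro p m
  simp only [hH p m, hf (H p) m]

lemma Good.comp {H K H' K' : ℝ × ℝ → ℝ × ℝ} (h : Good H K) (h' : Good H' K') :
    Good (fun p => H (H' p)) (fun p => K' (K p)) where
  cd := h.cd.comp h'.cd
  cdK := h'.cdK.comp h.cdK
  eqv := fun p m => by simp only [h'.eqv p m, h.eqv _ m]
  eqvK := fun p m => by simp only [h'.eqvK _ m, h.eqvK _ m]
  left := fun p => by simp only [h.left, h'.left]
  right := fun p => by simp only [h.right, h'.right]
  pres := fun f hf hp => by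
    have := h'.pres (fun p => f (H p)) (hf.comp h.cd.continuous) (hp.comp_eqv h.eqv)
    rw [this, h.pres f hf hp]

lemma Good.one : Good (fun p => p) (fun p => p) where
  cd := contDiff_id
  cdK := contDiff_id
  eqv := fun p m => rfl
  eqvK := fun p m => rfl
  left := fun p => rfl
  right := fun p => rfl
  pres := fun f hf hp => rfl

lemma I2_swap (f : ℝ × ℝ → ℝ) (hf : Continuous f) :
    I2 f = ∫ x in (0:ℝ)..1, ∫ y in (0:ℝ)..1, f (x, y) := by
  unfold I2
  have : Continuous (Function.uncurry fun (x y : ℝ) => f (y, x)) := by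
    simp only [Function.uncurry_def]; fun_prop
  simp only [intervalIntegral.integral_of_le zero_le_one]
  apply integral_integral_swap
  rw [Measure.prod_restrict]
  exact (this.continuousOn.integrableOn_compact (isCompact_Icc.prod isCompact_Icc)).mono_set
      (Set.prod_mono Set.Ioc_subset_Icc_self Set.Ioc_subset_Icc_self)

lemma per_int (φ : ℝ → ℝ) (hφ : ∀ x, φ (x + 1) = φ x) (t : ℝ) :
    ∫ x in (0:ℝ)..1, φ (x + t) = ∫ x in (0:ℝ)..1, φ x := by
  have hp : Function.Periodic φ 1 := hφ
  rw [intervalIntegral.integral_comp_add_right]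
  have := hp.intervalIntegral_add_eq t 0
  simpa [add_comm] using this

lemma per_int' (φ : ℝ → ℝ) (hφ : ∀ x, φ (x + 1) = φ x) (t : ℝ) :
    ∫ x in t..(t+1), φ x = ∫ x in (0:ℝ)..1, φ x := by
  have hp : Function.Periodic φ 1 := hφ
  have := hp.intervalIntegral_add_eq t 0
  simpa [add_comm] using this

lemma Biper.fst {E : Type*} {f : ℝ × ℝ → E} (hf : Biper f) (x y : ℝ) :
    f (x + 1, y) = f (x, y) := by
  simpa using hf (x, y) (1, 0)

lemma Biper.snd {E : Type*} {f : ℝ × ℝ → E} (hf : Biper f) (x y : ℝ) :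
    f (x, y + 1) = f (x, y) := by
  simpa using hf (x, y) (0, 1)

lemma per_int_cast {E : Type*} (g : ℝ → E) (hg : ∀ x, g (x + 1) = g x) (x : ℝ) (m : ℤ) :
    g (x + m) = g x := by
  have hp : Function.Periodic g 1 := hg
  simpa using hp.int_mul m x

lemma Good.vshear (g : ℝ → ℝ) (hg : ContDiff ℝ (⊤ : ℕ∞) g) (hp : ∀ x, g (x + 1) = g x) :
    Good (fun p => (p.1, p.2 + g p.1)) (fun p => (p.1, p.2 - g p.1)) where
  cd := by fun_prop
  cdK := by fun_prop
  eqv := fun p m => by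
    simp only [Prod.fst_add, Prod.snd_add, per_int_cast g hp, Prod.mk_add_mk, Prod.mk.injEq,
      Prod.ext_iff]
    exact ⟨trivial, by ring⟩
  eqvK := fun p m => by
    simp only [Prod.fst_add, Prod.snd_add, per_int_cast g hp, Prod.mk_add_mk, Prod.mk.injEq,
      Prod.ext_iff]
    exact ⟨trivial, by ring⟩
  left := fun p => by simp
  right := fun p => by simp
  pres := fun f hf hb => by
    have hgc := hg.continuous
    rw [I2_swap _ (by fun_prop), I2_swap _ hf]
    congr 1; ext x
    exact per_int (fun y => f (x, y)) (fun y => hb.snd x y) (g x)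

lemma Good.hshear (s : ℝ → ℝ) (hg : ContDiff ℝ (⊤ : ℕ∞) s) (hp : ∀ x, s (x + 1) = s x) :
    Good (fun p => (p.1 + s p.2, p.2)) (fun p => (p.1 - s p.2, p.2)) where
  cd := by fun_prop
  cdK := by fun_prop
  eqv := fun p m => by
    simp only [Prod.fst_add, Prod.snd_add, per_int_cast s hp, Prod.mk_add_mk, Prod.mk.injEq,
      Prod.ext_iff]
    exact ⟨by ring, trivial⟩
  eqvK := fun p m => by
    simp only [Prod.fst_add, Prod.snd_add, per_int_cast s hp, Prod.mk_add_mk, Prod.mk.injEq,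
      Prod.ext_iff]
    exact ⟨by ring, trivial⟩
  left := fun p => by simp
  right := fun p => by simp
  pres := fun f hf hb => by
    unfold I2
    congr 1; ext y
    exact per_int (fun x => f (x, y)) (fun x => hb.fst x y) (s y)

lemma Good.rot (t : ℝ) : Good (fun p => (p.1 + t, p.2)) (fun p => (p.1 - t, p.2)) :=
  Good.hshear (fun _ => t) contDiff_const (fun _ => rfl)

lemma Good.symm_rot {H K : ℝ × ℝ → ℝ × ℝ} (h : Good H K) (t : ℝ) :
    Good (fun p => H ((K p).1 + t, (K p).2)) (fun p => H ((K p).1 - t, (K p).2)) where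
  cd := h.cd.comp (((contDiff_fst.comp h.cdK).add contDiff_const).prodMk (contDiff_snd.comp h.cdK))
  cdK := h.cd.comp (((contDiff_fst.comp h.cdK).sub contDiff_const).prodMk (contDiff_snd.comp h.cdK))
  eqv := fun p m => by
    have := h.eqv ((K p).1 + t, (K p).2) m
    simp only [h.eqvK p m, ← this]
    congr 1
    ext <;> simp; ring
  eqvK := fun p m => by
    have := h.eqv ((K p).1 - t, (K p).2) m
    simp only [h.eqvK p m, ← this]
    congr 1
    ext <;> simp; ring
  left := fun p => by simp [h.left, h.right]
  right := fun p => by simp [h.left, h.right]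
  pres := fun f hf hb => by
    have hHc := h.cd.continuous
    have hKc := h.cdK.continuous
    have h1 := h.pres (fun p => f (H ((K p).1 + t, (K p).2))) (by fun_prop) (by
      intro p m
      have := h.eqv ((K p).1 + t, (K p).2) m
      have e : ((K p).1 + m.1 + t, (K p).2 + m.2) = (((K p).1 + t, (K p).2) + ((m.1:ℝ), (m.2:ℝ)))
          := by ext <;> simp; ring
      simp only [h.eqvK p m, Prod.fst_add, Prod.snd_add, e, this, hb _ m])
    rw [← h1]
    simp only [h.left]
    rw [(Good.rot t).pres (fun p => f (H p)) (by fun_prop) (hb.comp_eqv h.eqv), h.pres f hf hb]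

/-- every point is congruent to a point in the unit square -/
lemma exists_square (p : ℝ × ℝ) : ∃ p0 ∈ Set.Icc (0:ℝ) 1 ×ˢ Set.Icc (0:ℝ) 1, ∃ m : ℤ × ℤ,
    p = p0 + ((m.1 : ℝ), (m.2 : ℝ)) := by
  refine ⟨(Int.fract p.1, Int.fract p.2), ⟨⟨Int.fract_nonneg _, (Int.fract_lt_one _).le⟩,
    ⟨Int.fract_nonneg _, (Int.fract_lt_one _).le⟩⟩, (⌊p.1⌋, ⌊p.2⌋), ?_⟩
  ext <;> simp

lemma Biper.bounded {E : Type*} [SeminormedAddCommGroup E] {f : ℝ × ℝ → E} (hf : Biper f)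
    (hc : Continuous f) : ∃ C : ℝ, 0 ≤ C ∧ ∀ p, ‖f p‖ ≤ C := by
  obtain ⟨C, hC⟩ := (isCompact_Icc.prod isCompact_Icc : IsCompact
    (Set.Icc (0:ℝ) 1 ×ˢ Set.Icc (0:ℝ) 1)).exists_bound_of_continuousOn hc.continuousOn
  refine ⟨max C 0, le_max_right _ _, fun p => ?_⟩
  obtain ⟨p0, hp0, m, rfl⟩ := exists_square p
  rw [hf]
  exact (hC _ hp0).trans (le_max_left _ _)

lemma Good.lip {H K : ℝ × ℝ → ℝ × ℝ} (h : Good H K) : ∃ C : NNReal, LipschitzWith C H := by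
  have hb : Biper (fderiv ℝ H) := by
    intro p m
    have : (fun q => H (q + ((m.1:ℝ), (m.2:ℝ)))) = fun q => H q + ((m.1:ℝ), (m.2:ℝ)) :=
      funext fun q => h.eqv q m
    rw [← fderiv_comp_add_right, this, fderiv_add_const]
  obtain ⟨C, hC0, hC⟩ := hb.bounded (h.cd.continuous_fderiv (by simp))
  refine ⟨⟨C, hC0⟩, lipschitzWith_of_nnnorm_fderiv_le (h.cd.differentiable (by simp)) fun p => ?_⟩
  exact_mod_cast hC p

end Part1

open MeasureTheory Filter Topology
open scoped ENNReal
section Part2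
set_option linter.unusedVariables false
set_option linter.unusedSimpArgs false

lemma ck_close_aux (Ψ : ℝ × (ℝ × ℝ) → ℝ × ℝ) (hΨ : ContDiff ℝ (⊤ : ℕ∞) Ψ)
    (h0 : ∀ p, Ψ (0, p) = 0) (hper : ∀ t, Biper (fun p => Ψ (t, p))) (k : ℕ) (ε : ℝ)
    (hε : 0 < ε) :
    ∀ᶠ t in 𝓝 (0:ℝ), ∀ p, ‖iteratedFDeriv ℝ k (fun p => Ψ (t, p)) p‖ ≤ ε := by
  set ι : (ℝ × ℝ) →L[ℝ] ℝ × (ℝ × ℝ) := ContinuousLinearMap.inr ℝ ℝ (ℝ × ℝ)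
  have key : ∀ t p, iteratedFDeriv ℝ k (fun p => Ψ (t, p)) p =
      (iteratedFDeriv ℝ k Ψ (t, p)).compContinuousLinearMap (fun _ => ι) := by
    intro t p
    have h1 := ι.iteratedFDeriv_comp_right (n := (⊤ : ℕ∞)) (f := fun z => Ψ (z + (t, 0)))
      (by fun_prop) p (i := k) (by exact_mod_cast le_top)
    rw [iteratedFDeriv_comp_add_right] at h1
    have e1 : ((fun z => Ψ (z + (t, 0))) ∘ ι) = fun p => Ψ (t, p) := by
      ext p <;> simp [ι]
    rw [e1] at h1
    rw [h1]
    simp [ι]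
  have hcont : Continuous fun z : ℝ × (ℝ × ℝ) =>
      ‖(iteratedFDeriv ℝ k Ψ z).compContinuousLinearMap (fun _ => ι)‖ := by
    have h1 : Continuous (iteratedFDeriv ℝ k Ψ) :=
      hΨ.continuous_iteratedFDeriv (by exact_mod_cast le_top)
    exact ((ContinuousMultilinearMap.compContinuousLinearMapL (F := ℝ × ℝ)
      (fun _ : Fin k => ι)).continuous.comp h1).norm
  have h2 : ∀ᶠ t in 𝓝 (0:ℝ), ∀ p ∈ Set.Icc (0:ℝ) 1 ×ˢ Set.Icc (0:ℝ) 1,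
      ‖(iteratedFDeriv ℝ k Ψ (t, p)).compContinuousLinearMap (fun _ => ι)‖ < ε := by
    apply IsCompact.eventually_forall_of_forall_eventually (isCompact_Icc.prod isCompact_Icc)
    intro p hp
    have : ‖(iteratedFDeriv ℝ k Ψ (0, p)).compContinuousLinearMap (fun _ => ι)‖ < ε := by
      rw [← key]
      have : (fun p => Ψ (0, p)) = fun _ => 0 := funext h0
      rw [this]
      have : iteratedFDeriv ℝ k (fun _ : ℝ × ℝ => (0 : ℝ × ℝ)) p = 0 := by
        have := iteratedFDeriv_fun_zero (𝕜 := ℝ) (E := ℝ × ℝ) (F := ℝ × ℝ) (n := k)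
        exact congrFun this p
      rw [this]; simpa using hε
    exact (hcont.continuousAt (x := (0, p))).eventually (gt_mem_nhds this)
  filter_upwards [h2] with t ht p
  obtain ⟨p0, hp0, m, rfl⟩ := exists_square p
  have : (fun p => Ψ (t, p)) = fun p => Ψ (t, p + ((m.1 : ℝ), (m.2 : ℝ))) :=
    funext fun p => (hper t p m).symm
  have e := iteratedFDeriv_comp_add_right (𝕜 := ℝ) (f := fun p => Ψ (t, p)) k
    ((m.1 : ℝ), (m.2 : ℝ)) p0
  rw [← e, ← this, key]
  exact (ht p0 hp0).le

lemma ck_close {H K : ℝ × ℝ → ℝ × ℝ} (h : Good H K) (a : ℝ) (k : ℕ) (ε : ℝ) (hε : 0 < ε) :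
    ∀ᶠ t in 𝓝 (0:ℝ), ∀ p, ‖iteratedFDeriv ℝ k
      (fun p => H ((K p).1 + (a + t), (K p).2) - H ((K p).1 + a, (K p).2)) p‖ ≤ ε := by
  have hH := h.cd
  have hK := h.cdK
  apply ck_close_aux (fun z => H ((K z.2).1 + (a + z.1), (K z.2).2) - H ((K z.2).1 + a, (K z.2).2))
    _ _ _ k ε hε
  · fun_prop
  · intro p; simp
  · intro t p m
    have e1 := (h.symm_rot (a + t)).eqv p m
    have e2 := (h.symm_rot a).eqv p m
    simp only at e1 e2 ⊢
    rw [e1, e2]; abel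

/-- periodised cut-off linear function -/
lemma exists_ell (r R : ℝ) (hr : 0 < r) (hR : r < R) (hR2 : R < 1/2) :
    ∃ l : ℝ → ℝ, ContDiff ℝ (⊤ : ℕ∞) l ∧ (∀ x, l (x + 1) = l x) ∧
      (∀ x : ℝ, |x - round x| ≤ r → l x = x - round x) ∧
      (∀ x : ℝ, R ≤ |x - round x| → l x = 0) ∧ (∀ x, |l x| ≤ R) := by
  let b : ContDiffBump (0:ℝ) := ⟨r, R, hr, hR⟩
  let lam : ℝ → ℝ := fun t => t * b t
  have hlam : ContDiff ℝ (⊤ : ℕ∞) lam := contDiff_id.mul b.contDiff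
  have hz : ∀ t, R ≤ |t| → lam t = 0 := by
    intro t ht
    have : b t = 0 := b.zero_of_le_dist (by simpa [b] using ht)
    simp [lam, this]
  refine ⟨fun x => lam (x - round x), ?_, ?_, ?_, ?_, ?_⟩
  · rw [contDiff_iff_contDiffAt]
    intro x
    -- locally equals lam (y - round x) or zero
    have : ((fun y => lam (y - round y)) =ᶠ[𝓝 x] fun y => lam (y - round x)) ∨
        ((fun y => lam (y - round y)) =ᶠ[𝓝 x] fun _ => 0) := by
      by_cases hx : |x - round x| < 1/2
      · left
        have hcf : Continuous fun y : ℝ => |y - (round x : ℝ)| := by fun_prop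
        have : ∀ᶠ y : ℝ in 𝓝 x, |y - round x| < 1/2 :=
          hcf.continuousAt.eventually (gt_mem_nhds hx)
        filter_upwards [this] with y hy
        have : round y = round x := by
          rw [round_eq, Int.floor_eq_iff]
          rw [abs_lt] at hy
          constructor <;> linarith
        rw [this]
      · right
        have h1 : |x - round x| = 1/2 := le_antisymm (abs_sub_round x) (not_lt.1 hx)
        have hcf : Continuous fun y : ℝ => |y - x| := by fun_prop
        have : ∀ᶠ y in 𝓝 x, |y - x| < 1/2 - R :=
          hcf.continuousAt.eventually (gt_mem_nhds (by simp; linarith))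
        filter_upwards [this] with y hy
        apply hz
        have h2 : |x - round x| ≤ |x - round y| := round_le x (round y)
        have h3 : |x - round y| ≤ |x - y| + |y - round y| := abs_sub_le _ _ _
        rw [abs_sub_comm x y] at h3
        linarith
    rcases this with h | h
    · exact ContDiffAt.congr_of_eventuallyEq (by fun_prop) h
    · exact ContDiffAt.congr_of_eventuallyEq contDiffAt_const h
  · intro x
    have : round (x + 1) = round x + 1 := by exact_mod_cast round_add_intCast x 1
    simp only [this]; push_cast; congr 1; ring
  · intro x hx
    have : b (x - round x) = 1 := b.one_of_mem_closedBall (by simpa [b] using hx)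
    simp [lam, this]
  · intro x hx; exact hz _ hx
  · intro x
    by_cases hx : R ≤ |x - round x|
    · simp only [hz _ hx, abs_zero]; linarith
    · have h1 := b.nonneg' (x - round x)
      have h2 := b.le_one (x := x - round x)
      simp only [lam, abs_mul, abs_of_nonneg h1]
      calc _ ≤ |x - round x| * 1 := by gcongr
        _ ≤ R := by linarith
end Part2

open MeasureTheory Filter Topology
open scoped ENNReal
section Part3
set_option linter.unusedVariables false
set_option linter.unusedSimpArgs false

lemma sum_perm (q : ℕ) (hq : 0 < q) (p : ℤ) (hp : IsCoprime p q) (φ : ℝ → ℝ)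
    (hφ : ∀ x, φ (x + 1) = φ x) :
    ∑ i ∈ Finset.range q, φ (i * (p / q)) = ∑ i ∈ Finset.range q, φ (i / q) := by
  have hq' : (q : ℤ) ≠ 0 := by exact_mod_cast hq.ne'
  have hqp : (0 : ℤ) < q := by exact_mod_cast hq
  have hmaps : ∀ i ∈ Finset.range q, ((i * p : ℤ) % q).toNat ∈ Finset.range q := by
    intro i hi
    rw [Finset.mem_range]
    have h1 := Int.emod_lt_of_pos (i * p : ℤ) hqp
    have h2 := Int.emod_nonneg (i * p : ℤ) hq'
    omega
  have hinj : Set.InjOn (fun i : ℕ => ((i * p : ℤ) % q).toNat) (Finset.range q) := by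
    intro i hi j hj hij
    simp only [Finset.coe_range, Set.mem_Iio] at hi hj
    simp only at hij
    have h2 := Int.emod_nonneg (i * p : ℤ) hq'
    have h3 := Int.emod_nonneg (j * p : ℤ) hq'
    have h4 : (i * p : ℤ) % q = (j * p : ℤ) % q := by omega
    have h5 : (q : ℤ) ∣ (i * p - j * p) := Int.ModEq.dvd (show (j * p : ℤ) ≡ i * p [ZMOD q] from h4.symm)
    rw [← sub_mul] at h5
    have h6 : (q : ℤ) ∣ (i - j : ℤ) := (hp.symm).dvd_of_dvd_mul_right h5
    have h7 : (i - j : ℤ) = 0 := by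
      apply Int.eq_zero_of_abs_lt_dvd h6
      rw [abs_lt]; constructor <;> omega
    omega
  refine Finset.sum_nbij (fun i : ℕ => ((i * p : ℤ) % q).toNat) hmaps hinj ?_ ?_
  · exact Finset.surjOn_of_injOn_of_card_le _ hmaps hinj le_rfl
  · intro i hi
    have h2 := Int.emod_nonneg (i * p : ℤ) hq'
    have h3 : ((((i * p : ℤ) % q).toNat : ℕ) : ℝ) = (((i * p : ℤ) % q : ℤ) : ℝ) := by
      exact_mod_cast congrArg (Int.cast (R := ℝ)) (Int.toNat_of_nonneg h2)
    have h4 : (i * p : ℤ) = (i * p : ℤ) % q + q * ((i * p : ℤ) / q) := (Int.emod_add_mul_ediv _ _).symm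
    have h5 : ((i : ℝ) * p) = (((i * p : ℤ) % q : ℤ) : ℝ) + q * (((i * p : ℤ) / q : ℤ) : ℝ) := by
      exact_mod_cast congrArg (Int.cast (R := ℝ)) h4
    rw [h3]
    have hqr : (q : ℝ) ≠ 0 := by exact_mod_cast hq.ne'
    have : (i : ℝ) * (p / q) = (((i * p : ℤ) % q : ℤ) : ℝ) / q + (((i * p : ℤ) / q : ℤ) : ℝ) := by
      field_simp
      linarith
    rw [this, per_int_cast φ hφ]

lemma sum_vs_int (φ : ℝ → ℝ) (hc : Continuous φ) (β ε : ℝ) (hβ : 0 < β)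
    (hm : ∀ u v, |u - v| ≤ β → |φ u - φ v| ≤ ε) (x : ℝ) (N : ℕ) :
    |β * ∑ i ∈ Finset.range N, φ (x + i * β) - ∫ t in (0:ℝ)..(N * β), φ (x + t)| ≤ ε * N * β := by
  induction N with
  | zero => simp
  | succ N ih =>
    have hi : ∀ a b, IntervalIntegrable (fun t => φ (x + t)) volume a b :=
      fun a b => (Continuous.intervalIntegrable (by fun_prop) a b)
    rw [Finset.sum_range_succ, ← intervalIntegral.integral_add_adjacent_intervals (hi 0 (N * β))
      (hi _ ((N + 1 : ℕ) * β))]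
    have h1 : ∫ t in (N * β)..((N + 1 : ℕ) * β), φ (x + t) - φ (x + N * β) =
        (∫ t in (N * β)..((N + 1 : ℕ) * β), φ (x + t)) - β * φ (x + N * β) := by
      rw [intervalIntegral.integral_sub (hi _ _) (by simp)]
      simp only [intervalIntegral.integral_const, smul_eq_mul]; push_cast; ring
    have h2 : ‖∫ t in (N * β)..((N + 1 : ℕ) * β), φ (x + t) - φ (x + N * β)‖ ≤
        ε * |(N + 1 : ℕ) * β - N * β| := by
      apply intervalIntegral.norm_integral_le_of_norm_le_const
      intro t ht
      rw [Set.uIoc_of_le (by push_cast; nlinarith)] at ht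
      apply hm
      have := ht.1; have := ht.2
      push_cast at *
      rw [abs_le]; constructor <;> nlinarith
    rw [h1, Real.norm_eq_abs] at h2
    have h3 : |((N + 1 : ℕ) : ℝ) * β - N * β| = β := by
      push_cast; rw [show ((N : ℝ) + 1) * β - N * β = β by ring, abs_of_pos hβ]
    rw [h3] at h2
    rw [abs_le] at *
    push_cast at *
    constructor <;> nlinarith [ih.1, ih.2, h2.1, h2.2]

lemma riemann (F : ℝ × ℝ → ℝ) (hF : UniformContinuous F) (hb : Biper F) (ε : ℝ) (hε : 0 < ε) :
    ∀ᶠ q : ℕ in atTop, ∀ x y, |(q : ℝ)⁻¹ * ∑ r ∈ Finset.range q, F (x + r / q, y) -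
      ∫ s in (0:ℝ)..1, F (s, y)| ≤ ε := by
  obtain ⟨δ, hδ, hm⟩ := Metric.uniformContinuous_iff.1 hF ε hε
  have h1 : ∀ᶠ q : ℕ in atTop, (q : ℝ)⁻¹ < δ :=
    (tendsto_inv_atTop_zero.comp tendsto_natCast_atTop_atTop).eventually (gt_mem_nhds hδ)
  filter_upwards [h1, eventually_gt_atTop 0] with q hq hq0 x y
  have hq0' : (0:ℝ) < q := by exact_mod_cast hq0
  have hc := hF.continuous
  have h2 := sum_vs_int (fun s => F (s, y)) (by fun_prop) (q : ℝ)⁻¹ ε (by positivity) (by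
    intro u v huv
    have : dist (F (u, y)) (F (v, y)) < ε := hm (by
      rw [Prod.dist_eq]; simp only [Real.dist_eq, sub_self, abs_zero]; exact max_lt (by linarith) hδ)
    rw [Real.dist_eq] at this; exact this.le) x q
  have h3 : (q : ℝ) * (q : ℝ)⁻¹ = 1 := mul_inv_cancel₀ hq0'.ne'
  rw [h3, mul_assoc, h3] at h2
  have h4 := per_int (fun s => F (s, y)) (fun s => hb.fst s y) x
  simp only [add_comm _ x] at h4
  rw [h4] at h2
  simpa [div_eq_mul_inv] using h2

lemma shift_sum (u : ℕ → ℝ) (C : ℝ) (hu : ∀ i, |u i| ≤ C) (N r : ℕ) :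
    |∑ i ∈ Finset.range N, u i - ∑ i ∈ Finset.range N, u (i + r)| ≤ 2 * C * r := by
  induction r with
  | zero => simp
  | succ r ih =>
    have h1 : ∑ i ∈ Finset.range N, u (i + r) - ∑ i ∈ Finset.range N, u (i + (r + 1)) =
        u r - u (N + r) := by
      rw [← Finset.sum_sub_distrib]
      have := Finset.sum_range_sub' (fun i => u (i + r)) N
      simp only [zero_add] at this
      rw [← this]
      apply Finset.sum_congr rfl
      intro i _; congr 2; ring
    have h2 := hu r
    have h3 := hu (N + r)
    rw [abs_le] at *
    push_cast
    constructor <;> linarith [ih.1, ih.2, h2.1, h2.2, h3.1, h3.2]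

/-- averages of rotations by `p/q + β` -/
lemma orbit_avg (G : ℝ → ℝ) (hc : Continuous G) (hper : ∀ x, G (x + 1) = G x) (C ε β : ℝ)
    (hC : ∀ x, |G x| ≤ C) (q : ℕ) (hq : 0 < q) (p : ℤ) (hp : IsCoprime p q) (hβ : 0 < β)
    (hm : ∀ u v, |u - v| ≤ q * β → |G u - G v| ≤ ε) (x : ℝ) (N : ℕ) :
    |β * ∑ i ∈ Finset.range N, G (x + i * (p / q + β)) -
      ∫ t in (0:ℝ)..(N * β), (q : ℝ)⁻¹ * ∑ r ∈ Finset.range q, G (x + t + r / q)| ≤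
      β * (2 * ε * N + 2 * C * q) := by
  have hq0 : (0:ℝ) < q := by exact_mod_cast hq
  have hq1 : (1:ℝ) ≤ q := by exact_mod_cast hq
  have hC0 : 0 ≤ C := (abs_nonneg _).trans (hC 0)
  have hε0 : 0 ≤ ε := (abs_nonneg _).trans (hm 0 0 (by simp; positivity))
  set Φ : ℝ → ℝ := fun x => (q : ℝ)⁻¹ * ∑ r ∈ Finset.range q, G (x + r / q) with hΦ
  have hΦc : Continuous Φ := by fun_prop
  have avg : ∀ (u : ℕ → ℝ) (c : ℝ), (∀ r ∈ Finset.range q, |u r| ≤ c) →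
      |(q : ℝ)⁻¹ * ∑ r ∈ Finset.range q, u r| ≤ c := by
    intro u c hu
    rw [abs_mul, abs_of_pos (inv_pos.2 hq0), inv_mul_le_iff₀ hq0]
    refine (Finset.abs_sum_le_sum_abs _ _).trans ((Finset.sum_le_sum hu).trans ?_)
    simp
  have avgc : ∀ c : ℝ, (q : ℝ)⁻¹ * ∑ r ∈ Finset.range q, c = c := by
    intro c; simp; field_simp
  -- Φ periodic
  have hΦp : ∀ x, Φ (x + 1 / q) = Φ x := by
    intro x
    simp only [hΦ]
    congr 1
    have h1 := Finset.sum_range_succ (fun r : ℕ => G (x + r / q)) q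
    have h2 := Finset.sum_range_succ' (fun r : ℕ => G (x + r / q)) q
    rw [h1] at h2
    have h3 : G (x + (q:ℕ) / q) = G x := by rw [div_self hq0.ne', hper]
    rw [h3] at h2
    simp only [Nat.cast_zero, zero_div, add_zero, add_left_inj] at h2
    rw [h2]
    apply Finset.sum_congr rfl
    intro r _; congr 1; push_cast; ring
  have hΦi : ∀ x, ∀ j : ℤ, Φ (x + j / q) = Φ x := by
    intro x j
    have hp' : Function.Periodic Φ (1 / q) := hΦp
    have := hp'.int_mul j x
    rw [← this]; congr 1; ring
  -- Step 1
  have key : ∀ i : ℕ, (q : ℝ)⁻¹ * ∑ r ∈ Finset.range q, G (x + i * β + (i + r) * (p / q)) =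
      Φ (x + i * β) := by
    intro i
    have h1 := sum_perm q hq p hp (fun t => G (x + i * β + i * (p / q) + t))
      (fun t => by simp only [← add_assoc, hper])
    have h2 := hΦi (x + i * β) (i * p)
    rw [← h2]
    simp only [hΦ]
    congr 1
    have e1 : ∀ r : ℕ, x + i * β + (i + r) * ((p:ℝ) / q) = x + i * β + i * (p / q) + r * (p / q) :=
      fun r => by ring
    simp only [e1]
    rw [h1]
    apply Finset.sum_congr rfl
    intro r _; congr 1; push_cast; ring
  have step1 : |∑ i ∈ Finset.range N, G (x + i * (p / q + β)) -
      (q : ℝ)⁻¹ * ∑ r ∈ Finset.range q, ∑ i ∈ Finset.range N, G (x + (i + r : ℕ) * (p / q + β))| ≤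
      2 * C * q := by
    have := avg (fun r => ∑ i ∈ Finset.range N, G (x + i * (p / q + β)) -
      ∑ i ∈ Finset.range N, G (x + (i + r : ℕ) * (p / q + β))) (2 * C * q) (by
        intro r hr
        refine (shift_sum (fun i => G (x + i * (p / q + β))) C (fun i => hC _) N r).trans ?_
        have : (r:ℝ) ≤ q := by exact_mod_cast (Finset.mem_range.1 hr).le
        gcongr)
    rwa [Finset.sum_sub_distrib, mul_sub, avgc] at this
  have step2 : |(q : ℝ)⁻¹ * ∑ r ∈ Finset.range q, ∑ i ∈ Finset.range N,
      G (x + (i + r : ℕ) * (p / q + β)) - ∑ i ∈ Finset.range N, Φ (x + i * β)| ≤ ε * N := by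
    have e : ∑ i ∈ Finset.range N, Φ (x + i * β) = (q : ℝ)⁻¹ * ∑ r ∈ Finset.range q,
        ∑ i ∈ Finset.range N, G (x + i * β + (i + r) * (p / q)) := by
      rw [Finset.sum_comm, Finset.mul_sum]
      exact Finset.sum_congr rfl fun i _ => (key i).symm
    rw [e, ← mul_sub, ← Finset.sum_sub_distrib]
    apply avg
    intro r hr
    rw [← Finset.sum_sub_distrib]
    refine (Finset.abs_sum_le_sum_abs _ _).trans ((Finset.sum_le_sum (g := fun _ => ε) ?_).trans ?_)
    · intro i _
      apply hm
      have : (r:ℝ) ≤ q := by exact_mod_cast (Finset.mem_range.1 hr).le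
      have e : x + ((i + r : ℕ):ℝ) * (p / q + β) - (x + i * β + (i + r) * (p / q)) = r * β := by
        push_cast; ring
      rw [e, abs_of_nonneg (by positivity)]
      gcongr
    · simp; linarith
  have hΦm : ∀ u v, |u - v| ≤ β → |Φ u - Φ v| ≤ ε := by
    intro u v huv
    simp only [hΦ]
    rw [← mul_sub, ← Finset.sum_sub_distrib]
    apply avg
    intro r hr
    apply hm
    rw [show u + (r:ℝ) / q - (v + r / q) = u - v by ring]
    nlinarith
  have step3 := sum_vs_int Φ hΦc β ε hβ hΦm x N
  have h12 : |∑ i ∈ Finset.range N, G (x + i * (p / q + β)) - ∑ i ∈ Finset.range N, Φ (x + i * β)|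
      ≤ 2 * C * q + ε * N := (abs_sub_le _ _ _).trans (add_le_add step1 step2)
  have h13 : |β * ∑ i ∈ Finset.range N, G (x + i * (p / q + β)) -
      β * ∑ i ∈ Finset.range N, Φ (x + i * β)| ≤ β * (2 * C * q + ε * N) := by
    rw [← mul_sub, abs_mul, abs_of_pos hβ]; gcongr
  calc _ ≤ _ := abs_sub_le _ _ _
    _ ≤ _ := add_le_add h13 step3
    _ = _ := by ring
end Part3

open MeasureTheory Filter Topology
open scoped ENNReal
section Part4
set_option linter.unusedVariables false
set_option linter.unusedSimpArgs false

lemma prim_shift (ψ : ℝ → ℝ) (hc : Continuous ψ) (hp : ∀ x, ψ (x + 1) = ψ x) (m : ℕ) (s : ℝ) :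
    ∫ t in (0:ℝ)..(m + s), ψ t = m * (∫ t in (0:ℝ)..1, ψ t) + ∫ t in (0:ℝ)..s, ψ t := by
  have hi : ∀ a b, IntervalIntegrable ψ volume a b := fun a b => hc.intervalIntegrable a b
  induction m with
  | zero => simp
  | succ m ih =>
    rw [← intervalIntegral.integral_add_adjacent_intervals (hi 0 1) (hi 1 _)]
    have : ∫ t in (1:ℝ)..((m + 1 : ℕ) + s), ψ t = ∫ t in (0:ℝ)..(m + s), ψ t := by
      have h := intervalIntegral.integral_comp_add_right (a := 0) (b := m + s) ψ 1
      simp only [hp] at h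
      rw [h]; congr 1 <;> push_cast <;> ring
    rw [this, ih]; push_cast; ring

lemma int_mean_zero (φ : ℝ → ℝ) (hc : Continuous φ) (hp : ∀ x, φ (x + 1) = φ x)
    (h0 : ∫ t in (0:ℝ)..1, φ t = 0) (C : ℝ) (hC : ∀ x, |φ x| ≤ C) (u v : ℝ) (huv : u ≤ v) :
    |∫ t in u..v, φ t| ≤ C := by
  have hC0 : 0 ≤ C := (abs_nonneg _).trans (hC 0)
  set m := ⌊v - u⌋₊
  have e : ∫ t in u..v, φ t = ∫ t in (0:ℝ)..(v - u), φ (t + u) := by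
    rw [intervalIntegral.integral_comp_add_right]; simp
  have hp' : ∀ x, φ (x + 1 + u) = φ (x + u) := fun x => by
    rw [show x + 1 + u = x + u + 1 by ring, hp]
  have h1 := prim_shift (fun t => φ (t + u)) (by fun_prop) hp' m (v - u - m)
  have h2 : ∫ t in (0:ℝ)..1, φ (t + u) = 0 := by rw [per_int φ hp u, h0]
  rw [h2, mul_zero, zero_add, show (m:ℝ) + (v - u - m) = v - u by ring] at h1
  rw [e, h1]
  have h3 := intervalIntegral.norm_integral_le_of_norm_le_const (a := 0) (b := v - u - m)
    (f := fun t => φ (t + u)) (C := C) (fun x _ => hC _)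
  have h4 : (m:ℝ) ≤ v - u := Nat.floor_le (by linarith)
  have h5 : v - u < m + 1 := Nat.lt_floor_add_one _
  rw [Real.norm_eq_abs, sub_zero, abs_of_nonneg (a := v - u - m) (by linarith)] at h3
  exact h3.trans (by nlinarith)

set_option maxHeartbeats 1000000 in
lemma lemB (J Y : ℝ → ℝ) (hJ : Continuous J) (hJp : ∀ x, J (x + 1) = J x) (hY : Continuous Y)
    (hYp : ∀ x, Y (x + 1) = Y x) (C κ ε w : ℝ) (L : ℕ) (hL : 0 < L) (hκ : 0 < κ) (hκ2 : κ < 1/16)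
    (hC : ∀ x, |J x| ≤ C) (hm : ∀ u v, |u - v| ≤ w → |J u - J v| ≤ ε)
    (hε : 0 ≤ ε) (hY0 : ∀ s, 0 ≤ s → s ≤ 5/8 → Y s = 0)
    (hY1 : ∀ s, 5/8 + κ ≤ s → s ≤ 1 - κ → |Y s - L * (s - 13/16)| ≤ w)
    (I : ℝ) (hI : I = ∫ t in (0:ℝ)..1, J t) (η : ℝ) (hη : η = 4 * C * κ + ε + 2 * C / L) :
    |(∫ s in (0:ℝ)..1, J (Y s)) - I| ≤ 5/8 * |J 0 - I| + η ∧
    ∀ φ Θ : ℝ, Int.fract φ ≤ 1/2 → 0 ≤ Θ →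
      |∫ s in φ..(φ + Θ), (J (Y s) - I)| ≤ (|J 0 - I| + 8 * η) * Θ := by
  have hC0 : 0 ≤ C := (abs_nonneg _).trans (hC 0)
  have hLr : (0:ℝ) < L := by exact_mod_cast hL
  have hIC : |I| ≤ C := by
    have := intervalIntegral.norm_integral_le_of_norm_le_const (a := 0) (b := 1)
      (f := J) (C := C) (fun x _ => hC _)
    rw [hI]; simpa using this
  set ψ : ℝ → ℝ := fun s => J (Y s) - I with hψ
  have hψc : Continuous ψ := by fun_prop
  have hψp : ∀ x, ψ (x + 1) = ψ x := fun x => by simp only [hψ, hYp]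
  have hb : ∀ u : ℝ, |J u - I| ≤ 2 * C := fun u => (abs_sub _ _).trans (by linarith [hC u])
  have hi : ∀ a b, IntervalIntegrable ψ volume a b := fun a b => hψc.intervalIntegrable a b
  have hadd : ∀ a b c, ∫ s in a..c, ψ s = (∫ s in a..b, ψ s) + ∫ s in b..c, ψ s := fun a b c =>
    (intervalIntegral.integral_add_adjacent_intervals (hi a b) (hi b c)).symm
  have hbd : ∀ a b, a ≤ b → |∫ s in a..b, ψ s| ≤ 2 * C * (b - a) := by
    intro a b hab
    have := intervalIntegral.norm_integral_le_of_norm_le_const (a := a) (b := b)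
      (f := ψ) (C := 2 * C) (fun x _ => hb _)
    rwa [Real.norm_eq_abs, abs_of_nonneg (sub_nonneg.2 hab)] at this
  set ψ0 := J 0 - I
  have hE0 : ∀ s, 0 ≤ s → s ≤ 5/8 → ∫ t in (0:ℝ)..s, ψ t = ψ0 * s := by
    intro s h0 h1
    rw [intervalIntegral.integral_congr (g := fun _ => ψ0)]
    · simp; ring
    · intro t ht
      rw [Set.uIcc_of_le h0] at ht
      simp only [hψ, hY0 t ht.1 (ht.2.trans h1)]; rfl
  -- ramp
  have hramp : ∀ s, 5/8 + κ ≤ s → s ≤ 1 - κ → |∫ t in (5/8 + κ)..s, ψ t| ≤ ε + 2 * C / L := by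
    intro s h0 h1
    have e1 : ∫ t in (5/8 + κ)..s, (J (L * t - L * (13/16)) - I) =
        (L:ℝ)⁻¹ * ∫ t in (L * (5/8 + κ) - L * (13/16))..(L * s - L * (13/16)), (J t - I) := by
      rw [intervalIntegral.integral_comp_mul_sub (fun t => J t - I) hLr.ne']; simp
    have e2 : |∫ t in (L * (5/8 + κ) - L * (13/16))..(L * s - L * (13/16)), (J t - I)| ≤ 2 * C := by
      apply int_mean_zero (fun t => J t - I) (by fun_prop) (fun x => by simp only [hJp]) _ _ hb
      · nlinarith
      · rw [intervalIntegral.integral_sub (hJ.intervalIntegrable _ _) (by simp), ← hI]; simp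
    have e3 : |(∫ t in (5/8 + κ)..s, ψ t) - ∫ t in (5/8 + κ)..s, (J (L * t - L * (13/16)) - I)| ≤ ε := by
      rw [← intervalIntegral.integral_sub (hi _ _) (Continuous.intervalIntegrable (by fun_prop) _ _)]
      have := intervalIntegral.norm_integral_le_of_norm_le_const (a := 5/8 + κ) (b := s)
        (f := fun t => ψ t - (J (L * t - L * (13/16)) - I)) (C := ε) (by
          intro t ht
          rw [Set.uIoc_of_le h0] at ht
          simp only [hψ, sub_sub_sub_cancel_right]
          apply hm
          rw [← mul_sub]
          exact hY1 t ht.1.le (ht.2.trans h1))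
      rw [Real.norm_eq_abs, abs_of_nonneg (sub_nonneg.2 h0)] at this
      refine this.trans ?_
      nlinarith
    have e4 : |∫ t in (5/8 + κ)..s, (J (L * t - L * (13/16)) - I)| ≤ 2 * C / L := by
      rw [e1, abs_mul, abs_of_pos (inv_pos.2 hLr)]
      refine (mul_le_mul_of_nonneg_left e2 (inv_pos.2 hLr).le).trans_eq ?_
      field_simp
    rw [abs_le] at *
    constructor <;> linarith [e3.1, e3.2, e4.1, e4.2]
  have hE1 : ∀ s, 5/8 ≤ s → s ≤ 1 → |∫ t in (5/8)..s, ψ t| ≤ η := by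
    intro s h0 h1
    have hq : 0 ≤ 2 * C / L := by positivity
    have hCk : 0 ≤ C * κ := by positivity
    rcases le_total s (5/8 + κ) with h2 | h2
    · refine (hbd _ _ h0).trans ?_
      nlinarith
    · rw [hadd _ (5/8 + κ)]
      have a1 := hbd (5/8) (5/8 + κ) (by linarith)
      rcases le_total s (1 - κ) with h3 | h3
      · have a2 := hramp s h2 h3
        rw [abs_le] at *
        constructor <;> nlinarith [a1.1, a1.2, a2.1, a2.2]
      · rw [hadd _ (1 - κ) s]
        have a2 := hramp (1 - κ) (by linarith) le_rfl
        have a3 := hbd (1 - κ) s h3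
        have a4 : 2 * C * (s - (1 - κ)) ≤ 2 * C * κ := by nlinarith
        rw [abs_le] at *
        constructor <;> nlinarith [a1.1, a1.2, a2.1, a2.2, a3.1, a3.2]
  have hη0 : 0 ≤ η := (abs_nonneg _).trans (hE1 1 (by norm_num) le_rfl)
  have hE : ∀ s, 5/8 ≤ s → s ≤ 1 → |(∫ t in (0:ℝ)..s, ψ t) - ψ0 * (5/8)| ≤ η := by
    intro s h0 h1
    rw [hadd 0 (5/8) s, hE0 (5/8) (by norm_num) le_rfl, add_sub_cancel_left]
    exact hE1 s h0 h1
  constructor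
  · have h1 := hE 1 (by norm_num) le_rfl
    have h2 : ∫ t in (0:ℝ)..1, ψ t = (∫ s in (0:ℝ)..1, J (Y s)) - I := by
      rw [intervalIntegral.integral_sub (Continuous.intervalIntegrable (by fun_prop) _ _) (by simp)]
      simp
    rw [h2] at h1
    have h3 : |ψ0 * (5/8)| = 5/8 * |ψ0| := by rw [abs_mul]; norm_num; ring
    have h4 := abs_sub_abs_le_abs_sub ((∫ s in (0:ℝ)..1, J (Y s)) - I) (ψ0 * (5/8))
    linarith
  · intro φ Θ hφ hΘ
    -- reduce to φ in [0,1/2]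
    have hred : ∫ s in φ..(φ + Θ), ψ s = ∫ s in (Int.fract φ)..(Int.fract φ + Θ), ψ s := by
      have h := intervalIntegral.integral_comp_add_right (a := Int.fract φ) (b := Int.fract φ + Θ)
        ψ (⌊φ⌋ : ℝ)
      simp only [per_int_cast ψ hψp] at h
      rw [h]
      congr 1
      · exact (Int.fract_add_floor φ).symm
      · linarith [Int.fract_add_floor φ]
    rw [show (∫ s in φ..(φ + Θ), (J (Y s) - I)) = ∫ s in φ..(φ + Θ), ψ s from rfl, hred]
    have hf0 := Int.fract_nonneg φ
    generalize Int.fract φ = φ at hφ hf0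
    have e1 : ∫ s in φ..(φ + Θ), ψ s = (∫ s in (0:ℝ)..(φ + Θ), ψ s) - ψ0 * φ := by
      rw [hadd 0 φ (φ + Θ), hE0 φ hf0 (by linarith)]; ring
    rw [e1]
    set m := ⌊φ + Θ⌋₊
    set s := φ + Θ - m with hs
    have hm1 : (m:ℝ) ≤ φ + Θ := Nat.floor_le (by linarith)
    have hm2 : φ + Θ < m + 1 := Nat.lt_floor_add_one _
    have e2 := prim_shift ψ hψc hψp m s
    rw [show (m:ℝ) + s = φ + Θ by rw [hs]; ring] at e2
    rw [e2]
    have b1 := hE 1 (by norm_num) le_rfl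
    set E1 := ∫ t in (0:ℝ)..1, ψ t
    have hs0 : 0 ≤ s := by linarith
    have hs1 : s < 1 := by linarith
    obtain ⟨d, hd⟩ : ∃ d, d = E1 - ψ0 * (5/8) := ⟨_, rfl⟩
    rw [← hd] at b1
    have hE1' : E1 = ψ0 * (5/8) + d := by linarith
    -- final estimate
    have fin : ∀ c r : ℝ, 0 ≤ c → c ≤ Θ → |r| ≤ 8 * η * Θ →
        |ψ0 * c + r| ≤ (|ψ0| + 8 * η) * Θ := by
      intro c r hc1 hc2 hr
      calc _ ≤ |ψ0 * c| + |r| := abs_add_le _ _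
        _ ≤ |ψ0| * Θ + 8 * η * Θ := by
          rw [abs_mul, abs_of_nonneg hc1]; gcongr
        _ = _ := by ring
    rcases Nat.eq_zero_or_pos m with hm0 | hm0
    · have hm0' : (m:ℝ) = 0 := by exact_mod_cast hm0
      rw [hm0'] at hs ⊢
      rcases le_total s (5/8) with h | h
      · rw [hE0 s hs0 h]
        have := fin (s - φ) 0 (by linarith) (by linarith) (by rw [abs_zero]; positivity)
        convert this using 2; ring
      · have b2 := hE s h hs1.le
        have := fin (5/8 - φ) ((∫ t in (0:ℝ)..s, ψ t) - ψ0 * (5/8)) (by linarith) (by linarith)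
          (b2.trans (by nlinarith))
        convert this using 2; ring
    · have hm1' : (1:ℝ) ≤ m := by exact_mod_cast hm0
      rw [hE1']
      have hmd : |m * d| ≤ m * η := by rw [abs_mul, Nat.abs_cast]; gcongr
      have hmT : (m:ℝ) ≤ 2 * Θ := by linarith
      have hmE : (m:ℝ) * η ≤ 2 * Θ * η := mul_le_mul_of_nonneg_right hmT hη0
      have hE2 : η ≤ 2 * Θ * η := by nlinarith
      rcases le_total s (5/8) with h | h
      · rw [hE0 s hs0 h]
        have := fin (m * (5/8) + s - φ) (m * d) (by linarith) (by linarith)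
          (hmd.trans (by linarith))
        convert this using 2; ring
      · have b2 := hE s h hs1.le
        have := fin (m * (5/8) + 5/8 - φ) (m * d + ((∫ t in (0:ℝ)..s, ψ t) - ψ0 * (5/8)))
          (by linarith) (by linarith)
          ((abs_add_le _ _).trans ((add_le_add hmd b2).trans (by linarith)))
        convert this using 2; ring
end Part4

open MeasureTheory Filter Topology
open scoped ENNReal
section Part5
set_option linter.unusedVariables false
set_option linter.unusedSimpArgs false

lemma round_zero_of {x : ℝ} (h : |x| < 1/2) : round x = 0 := by
  rw [round_eq, Int.floor_eq_iff]
  rw [abs_lt] at h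
  constructor <;> push_cast <;> linarith [h.1, h.2]

set_option maxHeartbeats 1000000 in
lemma exists_G_h (q : ℕ) (hq : 0 < q) (κ : ℝ) (hκ : 0 < κ) (hκ2 : κ < 1/16) (L : ℕ)
    (δ : ℝ) (hδ : 0 < δ) (hδ2 : δ ≤ 1/2) :
    ∃ G : ℝ → ℝ, ContDiff ℝ (⊤ : ℕ∞) G ∧ (∀ x, G (x + 1) = G x) ∧
    ∀ w : ℝ, 0 < w → w ≤ 1/8 → ∃ h k : ℝ × ℝ → ℝ × ℝ, Good h k ∧
      (∀ (j : ℤ) (x y : ℝ), h (x + j / q, y) = ((h (x, y)).1 + j / q, (h (x, y)).2)) ∧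
      (∀ x : ℝ, Int.fract (q * x) ≤ 5/8 → h (x, 0) = (x, 0)) ∧
      (∀ s : ℝ, 5/8 + κ ≤ s → s ≤ 1 - κ → |(h (s / q, 0)).2 - L * (s - 13/16)| ≤ w) ∧
      (∀ x y : ℝ, w ≤ |y - round y| → (h (x, y)).1 = x ∧
        (3 * δ / 8 ≤ |q * x - 13/16 - round (q * x - 13/16)| → |(h (x, y)).2 - y| ≤ w / 4)) ∧
      (∀ x y : ℝ, |y - round y| < w → ∃ x' y' : ℝ, |y' - round y'| ≤ 2 * w ∧
        h (x, y) = (x', y' + G x')) := by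
  have hq0 : (0:ℝ) < q := by exact_mod_cast hq
  obtain ⟨l3, l3c, l3p, l3e, l3z, l3b⟩ := exists_ell (3 * δ / 16) (3 * δ / 8) (by linarith)
    (by linarith) (by linarith)
  obtain ⟨l1, l1c, l1p, l1e, l1z, l1b⟩ := exists_ell (3/16 - κ) (3/16) (by linarith)
    (by linarith) (by norm_num)
  -- periodicity helper
  have per : ∀ (l : ℝ → ℝ), (∀ x, l (x + 1) = l x) → ∀ (j : ℤ) (x : ℝ),
      l (q * (x + j / q) - 13/16) = l (q * x - 13/16) := by
    intro l hl j x
    rw [← per_int_cast l hl (q * x - 13/16) j]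
    congr 1; field_simp; ring
  have per1 : ∀ (l : ℝ → ℝ), (∀ x, l (x + 1) = l x) → ∀ (x : ℝ),
      l (q * (x + 1) - 13/16) = l (q * x - 13/16) := by
    intro l hl x
    rw [← per l hl q x]
    congr 3; push_cast; field_simp
  refine ⟨fun x => (L / δ) * l3 (q * x - 13/16), ?_, ?_, ?_⟩
  · exact contDiff_const.mul (l3c.comp ((contDiff_const.mul contDiff_id).sub contDiff_const))
  · intro x; simp only [per1 l3 l3p]
  intro w hw hw8
  obtain ⟨l2, l2c, l2p, l2e, l2z, l2b⟩ := exists_ell (w / 4) (w / 2) (by linarith)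
    (by linarith) (by linarith)
  set G : ℝ → ℝ := fun x => (L / δ) * l3 (q * x - 13/16) with hG
  set g : ℝ → ℝ := fun x => w * l1 (q * x - 13/16) with hg
  set s : ℝ → ℝ := fun y => -((1 - δ) / (q * w)) * l2 y with hs
  have g1 := Good.vshear g
    (contDiff_const.mul (l1c.comp ((contDiff_const.mul contDiff_id).sub contDiff_const)))
    (fun x => by simp only [hg, per1 l1 l1p])
  have g2 := Good.hshear s (contDiff_const.mul l2c) (fun x => by simp only [hs, l2p])
  have g3 := Good.vshear G
    (contDiff_const.mul (l3c.comp ((contDiff_const.mul contDiff_id).sub contDiff_const)))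
    (fun x => by simp only [hG, per1 l3 l3p])
  have gg := g3.comp (g2.comp g1)
  have hgb : ∀ x, |g x| ≤ 3 * w / 16 := by
    intro x
    simp only [hg, abs_mul, abs_of_pos hw]
    nlinarith [l1b (q * x - 13/16)]
  refine ⟨_, _, gg, ?_, ?_, ?_, ?_, ?_⟩
  · intro j x y
    have a1 : ∀ x, g (x + j / q) = g x := fun x => by simp only [hg, per l1 l1p]
    have a3 : ∀ x, G (x + j / q) = G x := fun x => by simp only [hG, per l3 l3p]
    simp only [a1]
    rw [show x + (j:ℝ) / q + s (y + g x) = x + s (y + g x) + j / q by ring, a3]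
  · intro x hx
    have hfar : ∀ n : ℤ, 3/16 ≤ |q * x - 13/16 - n| := by
      intro n
      have e := Int.fract_add_floor (q * x)
      have f0 := Int.fract_nonneg (q * x)
      rcases le_or_gt ⌊q * x⌋ n with h | h
      · have : ((⌊q * x⌋ : ℤ) : ℝ) ≤ n := by exact_mod_cast h
        rw [abs_sub_comm]
        exact le_trans (by linarith) (le_abs_self _)
      · have : (n : ℝ) + 1 ≤ (⌊q * x⌋ : ℤ) := by exact_mod_cast h
        exact le_trans (by linarith) (le_abs_self _)
    have z1 : g x = 0 := by simp only [hg, l1z _ (hfar _), mul_zero]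
    have z3 : G x = 0 := by
      simp only [hG]; rw [l3z _ (le_trans (by linarith) (hfar _)), mul_zero]
    have z2 : s 0 = 0 := by
      have : l2 0 = 0 := by rw [l2e 0 (by simp; linarith)]; simp
      simp only [hs, this, mul_zero]
    simp only [z1, add_zero, z2, z3]
  · intro t h0 h1
    have e1 : (q:ℝ) * (t / q) - 13/16 = t - 13/16 := by field_simp
    have ht : |t - 13/16| ≤ 3/16 - κ := by rw [abs_le]; constructor <;> linarith
    have hr : round (t - 13/16) = 0 := round_zero_of (by linarith)
    have hgt : g (t / q) = w * (t - 13/16) := by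
      simp only [hg, e1]; rw [l1e _ (by rw [hr]; simpa using ht), hr]; simp
    have hy1 : |w * (t - 13/16)| ≤ w / 4 := by
      rw [abs_mul, abs_of_pos hw]; nlinarith
    have hr2 : round (w * (t - 13/16)) = 0 := round_zero_of (by linarith)
    have hst : s (w * (t - 13/16)) = -((1 - δ) / q) * (t - 13/16) := by
      simp only [hs]; rw [l2e _ (by rw [hr2]; simpa using hy1), hr2]; simp; field_simp
    have e3 : (q:ℝ) * (t / q + -((1 - δ) / q) * (t - 13/16)) - 13/16 = δ * (t - 13/16) := by
      field_simp; ring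
    have h3 : |δ * (t - 13/16)| ≤ 3 * δ / 16 := by
      rw [abs_mul, abs_of_pos hδ]; nlinarith
    have hr3 : round (δ * (t - 13/16)) = 0 := round_zero_of (by linarith)
    have hGt : G (t / q + -((1 - δ) / q) * (t - 13/16)) = L * (t - 13/16) := by
      simp only [hG, e3]; rw [l3e _ (by rw [hr3]; simpa using h3), hr3]; simp; field_simp
    simp only [zero_add, hgt, hst, hGt]
    rw [add_sub_cancel_right]; linarith
  · intro x y hy
    have h1 : |y - round y| ≤ |y - round (y + g x)| := round_le y _
    have h2 : |y - round (y + g x)| ≤ |y + g x - round (y + g x)| + |g x| := by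
      have := abs_sub (y + g x - round (y + g x)) (g x)
      rwa [show y + g x - (round (y + g x) : ℝ) - g x = y - round (y + g x) by ring] at this
    have h3 := hgb x
    have z2 : s (y + g x) = 0 := by
      simp only [hs]; rw [l2z _ (by linarith), mul_zero]
    refine ⟨by simp only [z2, add_zero], ?_⟩
    intro hx
    have z3 : G x = 0 := by simp only [hG]; rw [l3z _ hx, mul_zero]
    simp only [z2, add_zero, z3]
    rw [add_sub_cancel_left]; linarith
  · intro x y hy
    refine ⟨_, y + g x, ?_, rfl⟩
    have h1 : |y + g x - round (y + g x)| ≤ |y + g x - round y| := round_le _ _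
    have h2 : |y + g x - round y| ≤ |y - round y| + |g x| := by
      have := abs_add_le (y - round y) (g x)
      rwa [show y - (round y : ℝ) + g x = y + g x - round y by ring] at this
    linarith [hgb x]
end Part5

open MeasureTheory Filter Topology
open scoped ENNReal
section Part6
set_option linter.unusedVariables false
set_option linter.unusedSimpArgs false

/-- sets with an efficient finite cover -/
def SmallSet (α ε : ℝ) (A : Set Torus2) : Prop :=
  ∃ (ι : Type) (_ : Fintype ι) (U : ι → Set Torus2) (r : ℝ), 0 ≤ r ∧ r ≤ ε ∧
    (Fintype.card ι : ℝ) * r ^ α ≤ ε ∧ A ⊆ (⋃ i, U i) ∧ ∀ i, Metric.ediam (U i) ≤ ENNReal.ofReal r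

lemma SmallSet.mono {α ε : ℝ} {A B : Set Torus2} (h : SmallSet α ε B) (hAB : A ⊆ B) : SmallSet α ε A := by
  obtain ⟨ι, hι, U, r, h0, h1, h2, h3, h4⟩ := h
  exact ⟨ι, hι, U, r, h0, h1, h2, hAB.trans h3, h4⟩

lemma small_asymp (α : ℝ) (hα : 1 < α) (q : ℕ) (K : NNReal) (ε : ℝ) (hε : 0 < ε) :
    ∀ᶠ ρ : ℝ in 𝓝[>] 0, 2 * K * ρ ≤ ε ∧ ((q * ⌈1/ρ⌉₊ : ℕ) : ℝ) * (2 * K * ρ) ^ α ≤ ε := by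
  have hpos : ∀ᶠ ρ : ℝ in 𝓝[>] 0, 0 < ρ := self_mem_nhdsWithin
  have h1 : Tendsto (fun ρ : ℝ => 2 * K * ρ) (𝓝[>] 0) (𝓝 0) := by
    have : Tendsto (fun ρ : ℝ => 2 * K * ρ) (𝓝 0) (𝓝 (2 * K * 0)) :=
      (continuous_const.mul continuous_id).tendsto 0
    rw [mul_zero] at this
    exact this.mono_left nhdsWithin_le_nhds
  have h2 : Tendsto (fun ρ : ℝ => q * (2 * K) ^ α * (ρ ^ (α - 1) + ρ ^ α)) (𝓝[>] 0) (𝓝 0) := by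
    have a1 : Tendsto (fun ρ : ℝ => ρ ^ (α - 1)) (𝓝 0) (𝓝 0) := by
      have := (Real.continuous_rpow_const (q := α - 1) (by linarith)).tendsto 0
      rwa [Real.zero_rpow (by linarith)] at this
    have a2 : Tendsto (fun ρ : ℝ => ρ ^ α) (𝓝 0) (𝓝 0) := by
      have := (Real.continuous_rpow_const (q := α) (by linarith)).tendsto 0
      rwa [Real.zero_rpow (by linarith)] at this
    have := (a1.add a2).const_mul (q * (2 * (K:ℝ)) ^ α)
    simp only [add_zero, mul_zero] at this
    exact this.mono_left nhdsWithin_le_nhds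
  filter_upwards [hpos, h1.eventually (gt_mem_nhds hε), h2.eventually (gt_mem_nhds hε)] with
    ρ hρ a b
  refine ⟨a.le, le_trans ?_ b.le⟩
  rw [Real.mul_rpow (by positivity) hρ.le]
  have h3 : ((⌈1/ρ⌉₊ : ℕ) : ℝ) ≤ 1/ρ + 1 := (Nat.ceil_lt_add_one (by positivity)).le
  have h4 : ρ ^ α = ρ ^ (α - 1) * ρ := by
    rw [Real.rpow_sub_one hρ.ne']; field_simp
  push_cast
  have h5 : 0 ≤ (2 * (K:ℝ)) ^ α * ρ ^ α := by positivity
  calc (q:ℝ) * ⌈1/ρ⌉₊ * ((2 * (K:ℝ)) ^ α * ρ ^ α) ≤ q * (1/ρ + 1) * ((2 * (K:ℝ)) ^ α * ρ ^ α) := by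
        gcongr
    _ = _ := by rw [h4]; field_simp

lemma small_strip (α : ℝ) (hα : 1 < α) (q : ℕ) (hq : 0 < q) (c : ℝ) (Φ : ℝ × ℝ → Torus2)
    (hb : Biper Φ) (K : NNReal) (hK : LipschitzWith K Φ) (ε : ℝ) (hε : 0 < ε) :
    ∀ᶠ ρ : ℝ in 𝓝[>] 0, SmallSet α ε
      (Φ '' {p | |q * p.1 - c - round (q * p.1 - c)| ≤ ρ}) := by
  have hpos : ∀ᶠ ρ : ℝ in 𝓝[>] 0, 0 < ρ := self_mem_nhdsWithin
  have hq0 : (0:ℝ) < q := by exact_mod_cast hq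
  have hq1 : (1:ℝ) ≤ q := by exact_mod_cast hq
  filter_upwards [hpos, small_asymp α hα q K ε hε] with ρ hρ hh
  set M := ⌈1/ρ⌉₊ with hM
  have hM0 : 0 < M := Nat.ceil_pos.2 (by positivity)
  have hMr : (0:ℝ) < M := by exact_mod_cast hM0
  have hMl : 1/ρ ≤ M := Nat.le_ceil _
  have hMi : 1/(M:ℝ) ≤ ρ := by
    rw [div_le_iff₀ hMr]; rw [div_le_iff₀ hρ] at hMl; linarith
  refine ⟨Fin q × Fin M, inferInstance, fun i => Φ '' (Set.Icc ((c + i.1 - ρ) / q) ((c + i.1 + ρ) / q)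
    ×ˢ Set.Icc ((i.2 : ℝ) / M) ((i.2 + 1) / M)), 2 * K * ρ, by positivity, hh.1, ?_, ?_, ?_⟩
  · simpa using hh.2
  · rintro _ ⟨p, hp, rfl⟩
    simp only [Set.mem_ofPred_eq] at hp
    set m := round (q * p.1 - c) with hm
    have hqz : (0:ℤ) < q := by exact_mod_cast hq
    have k0 := Int.emod_nonneg m hqz.ne'
    have k1 := Int.emod_lt_of_pos m hqz
    have kd := Int.emod_add_mul_ediv m q
    have f0 := Int.fract_nonneg p.2
    have f1 := Int.fract_lt_one p.2
    have i1 : ⌊M * Int.fract p.2⌋₊ < M := by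
      rw [Nat.floor_lt (by positivity)]; nlinarith
    have i2 : (⌊M * Int.fract p.2⌋₊ : ℝ) ≤ M * Int.fract p.2 := Nat.floor_le (by positivity)
    have i3 : M * Int.fract p.2 < ⌊M * Int.fract p.2⌋₊ + 1 := Nat.lt_floor_add_one _
    rw [Set.mem_iUnion]
    refine ⟨(⟨(m % q).toNat, by omega⟩, ⟨⌊M * Int.fract p.2⌋₊, i1⟩),
      p + (((-(m / q) : ℤ) : ℝ), ((-⌊p.2⌋ : ℤ) : ℝ)), ?_, hb p (-(m / q), -⌊p.2⌋)⟩
    have kc : (((m % q).toNat : ℕ) : ℝ) = ((m % q : ℤ) : ℝ) := by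
      exact_mod_cast congrArg (Int.cast (R := ℝ)) (Int.toNat_of_nonneg k0)
    have kd' : ((m % q : ℤ) : ℝ) + q * ((m / q : ℤ) : ℝ) = m := by exact_mod_cast kd
    simp only [Set.mem_prod, Set.mem_Icc, Prod.fst_add, Prod.snd_add, kc]
    push_cast
    rw [abs_le] at hp
    have fe : p.2 + -(⌊p.2⌋:ℝ) = Int.fract p.2 := by rw [Int.fract]; ring
    rw [fe, div_le_iff₀ hq0, le_div_iff₀ hq0, div_le_iff₀ hMr, le_div_iff₀ hMr]
    refine ⟨⟨?_, ?_⟩, ⟨?_, ?_⟩⟩ <;> nlinarith [hp.1, hp.2]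
  · intro i
    refine (hK.ediam_image_le _).trans ?_
    have : Metric.ediam (Set.Icc ((c + (i.1:ℝ) - ρ) / q) ((c + i.1 + ρ) / q)
      ×ˢ Set.Icc ((i.2 : ℝ) / M) ((i.2 + 1) / M)) ≤ ENNReal.ofReal (2 * ρ) := by
      apply Metric.ediam_le
      rintro ⟨x, y⟩ ⟨hx, hy⟩ ⟨x', y'⟩ ⟨hx', hy'⟩
      rw [edist_dist]
      apply ENNReal.ofReal_le_ofReal
      simp only [Set.mem_Icc] at hx hy hx' hy'
      rw [Prod.dist_eq]
      apply max_le
      · rw [Real.dist_eq]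
        have e : (c + (i.1:ℝ) + ρ) / q - (c + i.1 - ρ) / q ≤ 2 * ρ := by
          rw [← sub_div, div_le_iff₀ hq0]; nlinarith
        rw [abs_le]; constructor <;> linarith [hx.1, hx.2, hx'.1, hx'.2]
      · rw [Real.dist_eq]
        have e : ((i.2:ℝ) + 1) / M - i.2 / M = 1 / M := by rw [← sub_div]; ring
        rw [abs_le]; constructor <;> linarith [hy.1, hy.2, hy'.1, hy'.2]
    calc _ ≤ (K : ℝ≥0∞) * ENNReal.ofReal (2 * ρ) := by gcongr
      _ = _ := by
        rw [← ENNReal.ofReal_coe_nnreal, ← ENNReal.ofReal_mul (by positivity)]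
        congr 1; ring

lemma limsup_small_haus (α : ℝ) (hα : 1 < α) (A : ℕ → Set Torus2)
    (hA : ∀ n, SmallSet α ((1/2) ^ n) (A n)) (B : Set Torus2)
    (hB : ∀ z ∈ B, ∀ n1, ∃ n, n1 ≤ n ∧ z ∈ A n) : dimH B ≤ ENNReal.ofReal α := by
  choose ι hι U r h0 h1 h2 h3 h4 using hA
  have hs : Summable fun n : ℕ => ((1:ℝ)/2) ^ n := summable_geometric_two
  have key : μH[α] B ≤ liminf (fun n1 : ℕ => ∑' (i : Σ n : ℕ, ι (n + n1)),
      Metric.ediam (U (i.1 + n1) i.2) ^ α) atTop := by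
    have : ∀ n1 : ℕ, Countable (Σ n : ℕ, ι (n + n1)) := fun n1 => by
      have : ∀ n, Countable (ι (n + n1)) := fun n => Finite.to_countable
      infer_instance
    refine Measure.hausdorffMeasure_le_liminf_tsum α B
      (fun n1 : ℕ => ENNReal.ofReal ((1/2) ^ n1)) ?_
      (fun n1 (i : Σ n : ℕ, ι (n + n1)) => U (i.1 + n1) i.2) ?_ ?_
    · rw [← ENNReal.ofReal_zero]
      exact ENNReal.tendsto_ofReal (tendsto_pow_atTop_nhds_zero_of_lt_one (by norm_num) (by norm_num))
    · filter_upwards with n1 i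
      refine (h4 _ _).trans (ENNReal.ofReal_le_ofReal ((h1 _).trans ?_))
      exact pow_le_pow_of_le_one (by norm_num) (by norm_num) (by omega)
    · filter_upwards with n1 z hz
      obtain ⟨n, hn, hzn⟩ := hB z hz n1
      obtain ⟨m, rfl⟩ : ∃ m, n = m + n1 := ⟨n - n1, by omega⟩
      obtain ⟨i, hi⟩ := Set.mem_iUnion.1 (h3 _ hzn)
      exact Set.mem_iUnion.2 ⟨⟨m, i⟩, hi⟩
  have bound : ∀ n, ∑' i : ι n, Metric.ediam (U n i) ^ α ≤ ENNReal.ofReal ((1/2) ^ n) := by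
    intro n
    rw [tsum_fintype]
    calc ∑ i : ι n, Metric.ediam (U n i) ^ α ≤ ∑ i : ι n, ENNReal.ofReal (r n ^ α) := by
          apply Finset.sum_le_sum
          intro i _
          rw [← ENNReal.ofReal_rpow_of_nonneg (h0 n) (by linarith)]
          exact ENNReal.rpow_le_rpow (h4 n i) (by linarith)
      _ = ENNReal.ofReal ((Fintype.card (ι n) : ℝ) * r n ^ α) := by
          rw [Finset.sum_const, Finset.card_univ, ENNReal.ofReal_mul (by positivity)]
          simp
      _ ≤ _ := ENNReal.ofReal_le_ofReal (h2 n)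
  have hz : μH[α] B = 0 := by
    have hlim : Tendsto (fun n1 : ℕ => ∑' n : ℕ, ENNReal.ofReal ((1/2) ^ (n + n1))) atTop (𝓝 0) := by
      refine ENNReal.tendsto_sum_nat_add (fun n => ENNReal.ofReal ((1/2) ^ n)) ?_
      rw [← ENNReal.ofReal_tsum_of_nonneg (fun n => by positivity) hs]
      exact ENNReal.ofReal_ne_top
    refine le_antisymm (key.trans ?_) bot_le
    rw [← hlim.liminf_eq]
    refine liminf_le_liminf (Eventually.of_forall fun n1 => ?_)
    rw [ENNReal.tsum_sigma']
    exact ENNReal.tsum_le_tsum fun n => bound _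
  refine dimH_le_of_hausdorffMeasure_ne_top (d := α.toNNReal) ?_
  rw [Real.coe_toNNReal α (by linarith), hz]
  simp

lemma vol_le_diam (U : Set Torus2) (r : ℝ) (hr : 0 ≤ r) (h : Metric.ediam U ≤ ENNReal.ofReal r) :
    volume U ≤ ENNReal.ofReal (4 * r ^ 2) := by
  rcases U.eq_empty_or_nonempty with rfl | ⟨z, hz⟩
  · simp
  have : U ⊆ Metric.closedBall z.1 r ×ˢ Metric.closedBall z.2 r := by
    intro y hy
    have h1 : edist y z ≤ ENNReal.ofReal r := (Metric.edist_le_ediam_of_mem hy hz).trans h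
    rw [edist_dist, ENNReal.ofReal_le_ofReal_iff hr, Prod.dist_eq] at h1
    exact ⟨(le_max_left _ _).trans h1, (le_max_right _ _).trans h1⟩
  refine (measure_mono this).trans ?_
  rw [Measure.volume_eq_prod, Measure.prod_prod, AddCircle.volume_closedBall, AddCircle.volume_closedBall,
    ← ENNReal.ofReal_mul (by positivity)]
  apply ENNReal.ofReal_le_ofReal
  have : min 1 (2 * r) ≤ 2 * r := min_le_right _ _
  have h0 : 0 ≤ min 1 (2 * r) := by positivity
  nlinarith

lemma limsup_small_vol (α : ℝ) (hα : 1 < α) (hα2 : α < 2) (A : ℕ → Set Torus2)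
    (hA : ∀ n, SmallSet α ((1/2) ^ n) (A n)) (B : Set Torus2)
    (hB : ∀ z ∈ B, ∀ n1, ∃ n, n1 ≤ n ∧ z ∈ A n) : volume B = 0 := by
  have hv : ∀ n, volume (A n) ≤ ENNReal.ofReal (4 * (1/2) ^ n) := by
    intro n
    obtain ⟨ι, hι, U, r, h0, h1, h2, h3, h4⟩ := hA n
    have hr1 : r ≤ 1 := h1.trans (pow_le_one₀ (by norm_num) (by norm_num))
    have hr2 : r ^ 2 ≤ r ^ α := by
      rcases h0.eq_or_lt with h | h
      · rw [← h, Real.zero_rpow (by linarith)]; norm_num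
      · rw [← Real.rpow_natCast]
        exact Real.rpow_le_rpow_of_exponent_ge h hr1 (by push_cast; linarith)
    calc volume (A n) ≤ volume (⋃ i, U i) := measure_mono h3
      _ ≤ ∑' i, volume (U i) := measure_iUnion_le _
      _ ≤ ∑ i : ι, ENNReal.ofReal (4 * r ^ 2) := by
        rw [tsum_fintype]; exact Finset.sum_le_sum fun i _ => vol_le_diam _ r h0 (h4 i)
      _ = ENNReal.ofReal ((Fintype.card ι : ℝ) * (4 * r ^ 2)) := by
        rw [Finset.sum_const, Finset.card_univ, ENNReal.ofReal_mul (by positivity)]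
        simp
      _ ≤ _ := by
        apply ENNReal.ofReal_le_ofReal
        have : (Fintype.card ι : ℝ) * r ^ 2 ≤ Fintype.card ι * r ^ α := by gcongr
        linarith
  have hs : Summable fun n : ℕ => 4 * ((1:ℝ)/2) ^ n := summable_geometric_two.mul_left 4
  refine measure_mono_null (t := limsup A atTop) ?_ (measure_limsup_atTop_eq_zero ?_)
  · intro z hz
    rw [mem_limsup_iff_frequently_mem, frequently_atTop]
    exact fun n1 => (hB z hz n1)
  · refine ((ENNReal.tsum_le_tsum hv).trans_lt ?_).ne
    rw [← ENNReal.ofReal_tsum_of_nonneg (fun n => by positivity) hs]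
    exact ENNReal.ofReal_lt_top
end Part6

open MeasureTheory Filter Topology
open scoped ENNReal
section Part7
set_option linter.unusedVariables false
set_option linter.unusedSimpArgs false

lemma step3a (G JY : ℝ → ℝ) (hc : Continuous G) (hper : ∀ x, G (x + 1) = G x) (hJc : Continuous JY)
    (hJp : ∀ x, JY (x + 1) = JY x) (q : ℕ) (hq : 0 < q) (ε0 : ℝ)
    (hΨ : ∀ x, |(q : ℝ)⁻¹ * ∑ r ∈ Finset.range q, G (x + r / q) - JY (q * x)| ≤ ε0) :
    |(∫ x in (0:ℝ)..1, G x) - ∫ x in (0:ℝ)..1, JY x| ≤ ε0 := by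
  have hq0 : (0:ℝ) < q := by exact_mod_cast hq
  have e1 : ∫ x in (0:ℝ)..1, G x =
      ∫ x in (0:ℝ)..1, (q : ℝ)⁻¹ * ∑ r ∈ Finset.range q, G (x + r / q) := by
    rw [intervalIntegral.integral_const_mul, intervalIntegral.integral_finsetSum]
    · have : ∀ r : ℕ, ∫ x in (0:ℝ)..1, G (x + r / q) = ∫ x in (0:ℝ)..1, G x := fun r =>
        per_int G hper _
      simp only [this, Finset.sum_const, Finset.card_range, nsmul_eq_mul]
      field_simp
    · intro r _; exact Continuous.intervalIntegrable (by fun_prop) _ _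
  have e2 : ∫ x in (0:ℝ)..1, JY x = ∫ x in (0:ℝ)..1, JY (q * x) := by
    rw [intervalIntegral.integral_comp_mul_left _ hq0.ne']
    have := prim_shift JY hJc hJp q 0
    simp only [add_zero, intervalIntegral.integral_same] at this
    rw [mul_zero, mul_one, this, smul_eq_mul]; field_simp
  rw [e1, e2, ← intervalIntegral.integral_sub (Continuous.intervalIntegrable (by fun_prop) _ _)
    (Continuous.intervalIntegrable (by fun_prop) _ _)]
  have := intervalIntegral.norm_integral_le_of_norm_le_const (a := 0) (b := 1)
      (f := fun x => (q : ℝ)⁻¹ * ∑ r ∈ Finset.range q, G (x + r / q) - JY (q * x)) (C := ε0)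
      (fun x _ => hΨ x)
  simpa using this

lemma step3b (G JY : ℝ → ℝ) (hc : Continuous G) (hper : ∀ x, G (x + 1) = G x) (hJc : Continuous JY)
    (hJp : ∀ x, JY (x + 1) = JY x) (q : ℕ) (hq : 0 < q) (ε0 : ℝ)
    (hΨ : ∀ x, |(q : ℝ)⁻¹ * ∑ r ∈ Finset.range q, G (x + r / q) - JY (q * x)| ≤ ε0)
    (C ε β : ℝ) (hC : ∀ x, |G x| ≤ C) (p : ℤ) (hp : IsCoprime p q) (hβ : 0 < β)
    (hm : ∀ u v, |u - v| ≤ q * β → |G u - G v| ≤ ε) (I A2 : ℝ)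
    (hA2 : ∀ φ Θ : ℝ, Int.fract φ ≤ 1/2 → 0 ≤ Θ → |∫ s in φ..(φ + Θ), (JY s - I)| ≤ A2 * Θ)
    (x : ℝ) (hx : Int.fract (q * x) ≤ 1/2) (N : ℕ) :
    |∑ i ∈ Finset.range N, G (x + i * (p / q + β)) - N * I| ≤ N * (A2 + ε0 + 2 * ε) + 2 * C * q := by
  have hq0 : (0:ℝ) < q := by exact_mod_cast hq
  have h1 := orbit_avg G hc hper C ε β hC q hq p hp hβ hm x N
  have hN : (0:ℝ) ≤ N * β := by positivity
  have h2 : |(∫ t in (0:ℝ)..(N * β), (q : ℝ)⁻¹ * ∑ r ∈ Finset.range q, G (x + t + r / q)) -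
      ∫ t in (0:ℝ)..(N * β), JY (q * (x + t))| ≤ ε0 * (N * β) := by
    rw [← intervalIntegral.integral_sub (Continuous.intervalIntegrable (by fun_prop) _ _)
      (Continuous.intervalIntegrable (by fun_prop) _ _)]
    have := intervalIntegral.norm_integral_le_of_norm_le_const (a := 0) (b := N * β)
      (f := fun t => (q : ℝ)⁻¹ * ∑ r ∈ Finset.range q, G (x + t + r / q) - JY (q * (x + t)))
      (C := ε0) (fun t _ => hΨ (x + t))
    rwa [Real.norm_eq_abs, sub_zero, abs_of_nonneg hN] at this
  have h3 : |(∫ t in (0:ℝ)..(N * β), JY (q * (x + t))) - N * β * I| ≤ A2 * (N * β) := by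
    have e1 : (∫ t in (0:ℝ)..(N * β), JY (q * (x + t))) - N * β * I =
        ∫ t in (0:ℝ)..(N * β), (JY (q * x + q * t) - I) := by
      rw [intervalIntegral.integral_sub (Continuous.intervalIntegrable (by fun_prop) _ _) (by simp)]
      simp [mul_add]
    have e2 : ∫ t in (0:ℝ)..(N * β), (JY (q * x + q * t) - I) =
        (q:ℝ)⁻¹ * ∫ s in (q * x)..(q * x + q * (N * β)), (JY s - I) := by
      rw [intervalIntegral.integral_comp_add_mul (fun s => JY s - I) hq0.ne']; simp
    rw [e1, e2, abs_mul, abs_of_pos (inv_pos.2 hq0), inv_mul_le_iff₀ hq0]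
    refine (hA2 (q * x) (q * (N * β)) hx (by positivity)).trans_eq (by ring)
  have h4 : |β * (∑ i ∈ Finset.range N, G (x + i * (p / q + β)) - N * I)| ≤
      β * (N * (A2 + ε0 + 2 * ε) + 2 * C * q) := by
    have : β * (∑ i ∈ Finset.range N, G (x + i * (p / q + β)) - N * I) =
      (β * ∑ i ∈ Finset.range N, G (x + i * (p / q + β)) -
        ∫ t in (0:ℝ)..(N * β), (q : ℝ)⁻¹ * ∑ r ∈ Finset.range q, G (x + t + r / q)) +
      ((∫ t in (0:ℝ)..(N * β), (q : ℝ)⁻¹ * ∑ r ∈ Finset.range q, G (x + t + r / q)) -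
      ∫ t in (0:ℝ)..(N * β), JY (q * (x + t))) +
      ((∫ t in (0:ℝ)..(N * β), JY (q * (x + t))) - N * β * I) := by ring
    rw [this]
    refine (abs_add_three _ _ _).trans ((add_le_add (add_le_add h1 h2) h3).trans_eq (by ring))
  rw [abs_mul, abs_of_pos hβ] at h4
  exact le_of_mul_le_mul_left h4 hβ

/-- state of the construction -/
structure St where
  H : ℝ × ℝ → ℝ × ℝ
  K : ℝ × ℝ → ℝ × ℝ
  a : ℝ
  l : ℕ
  w : ℝ

def St.T (S : St) (p : ℝ × ℝ) : ℝ × ℝ := S.H ((S.K p).1 + S.a, (S.K p).2)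
def St.Ti (S : St) (p : ℝ × ℝ) : ℝ × ℝ := S.H ((S.K p).1 - S.a, (S.K p).2)

/-- circle averages -/
def Jf (H : ℝ × ℝ → ℝ × ℝ) (f : ℝ × ℝ → ℝ) (y : ℝ) : ℝ := ∫ x in (0:ℝ)..1, f (H (x, y))

structure Valid (D : ℕ) (fs : ℕ → ℝ × ℝ → ℝ) (n : ℕ) (S : St) : Prop where
  good : Good S.H S.K
  cop : ∃ p : ℤ, S.a = p / (D ^ S.l : ℕ) ∧ IsCoprime p (D ^ S.l : ℕ)
  wpos : 0 < S.w
  avg : ∀ j < n, ∀ x y, |((D ^ S.l : ℕ) : ℝ)⁻¹ * ∑ r ∈ Finset.range (D ^ S.l),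
    fs j (S.H (x + r / (D ^ S.l : ℕ), y)) - Jf S.H (fs j) y| ≤ (1/2) ^ n

structure Step (α : ℝ) (D : ℕ) (fs : ℕ → ℝ × ℝ → ℝ) (C : ℕ → ℝ) (n : ℕ) (S S' : St) : Prop where
  llt : S.l < S'.l
  wle : S'.w ≤ S.w / 8
  w8 : S'.w ≤ 1 / 8
  ck : ∀ k ≤ n, ∀ p, ‖iteratedFDeriv ℝ k (fun p => S'.T p - S.T p) p‖ ≤ (1/2) ^ n
  cki : ∀ k ≤ n, ∀ p, ‖iteratedFDeriv ℝ k (fun p => S'.Ti p - S.Ti p) p‖ ≤ (1/2) ^ n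
  close : ∀ i ≤ (n + 1) * D ^ S.l, ∀ p, dist (S'.T^[i] p) (S.T^[i] p) ≤ (1/2) ^ n
  e3a : ∀ j < n, |Jf S'.H (fs j) 0 - I2 (fs j)| ≤ 5/8 * |Jf S.H (fs j) 0 - I2 (fs j)| + 2 * (1/2) ^ n
  e3b : ∀ j < n, ∀ x, Int.fract (((D ^ S.l : ℕ) : ℝ) * x) ≤ 1/2 → ∀ N : ℕ,
    |∑ i ∈ Finset.range N, fs j (S'.H (x + i * S'.a, 0)) - N * I2 (fs j)| ≤
      N * (|Jf S.H (fs j) 0 - I2 (fs j)| + 2 * (1/2) ^ n) + 2 * C j * (D ^ S.l : ℕ)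
  fix : ∀ x, Int.fract (((D ^ S.l : ℕ) : ℝ) * x) ≤ 1/2 → S'.H (x, 0) = S.H (x, 0)
  geo : ∃ (h : ℝ × ℝ → ℝ × ℝ) (Col : Set ℝ), MeasurableSet Col ∧
    volume (Col ∩ Set.Icc 0 1) ≤ ENNReal.ofReal ((1/2) ^ (n + 4)) ∧
    (∀ p, S'.H p = S.H (h p)) ∧ (∀ p, h (S'.K p) = S.K p) ∧
    SmallSet α ((1/2) ^ n) ((fun p => torusProj (S.H p)) '' {p | p.1 ∈ Col}) ∧
    SmallSet α ((1/2) ^ n) ((fun p => torusProj (S'.H p)) '' {p | |p.2 - round p.2| < S'.w}) ∧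
    ∀ x y : ℝ, S'.w ≤ |y - round y| → (h (x, y)).1 = x ∧ (x ∉ Col → |(h (x, y)).2 - y| ≤ S'.w / 4)

lemma St.iter (S : St) (h : Good S.H S.K) (i : ℕ) (p : ℝ × ℝ) :
    S.T^[i] p = S.H ((S.K p).1 + i * S.a, (S.K p).2) := by
  induction i with
  | zero => simp [h.right]
  | succ i ih =>
    rw [Function.iterate_succ_apply', ih, St.T, h.left]
    simp only; push_cast; congr 2; ring

lemma torusProj_lip : LipschitzWith 1 torusProj := by
  apply LipschitzWith.of_dist_le_mul
  intro p p'
  have key : ∀ x y : ℝ, dist (x : UnitAddCircle) (y : UnitAddCircle) ≤ dist x y := by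
    intro x y
    rw [dist_eq_norm, dist_eq_norm, ← AddCircle.coe_sub]
    exact QuotientAddGroup.norm_mk_le_norm
  rw [NNReal.coe_one, one_mul, Prod.dist_eq, Prod.dist_eq]
  exact max_le_max (key _ _) (key _ _)

lemma torusProj_biper : Biper torusProj := by
  intro p m
  simp only [torusProj, Prod.fst_add, Prod.snd_add, AddCircle.coe_add]
  have : ∀ k : ℤ, ((k : ℝ) : UnitAddCircle) = 0 := fun k => by
    rw [AddCircle.coe_eq_zero_iff]; exact ⟨k, by simp⟩
  simp [this]

lemma col_vol (q : ℕ) (hq : 0 < q) (ρ : ℝ) (hρ : 0 < ρ) :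
    volume ({x : ℝ | |q * x - 13/16 - round (q * x - 13/16)| < ρ} ∩ Set.Icc 0 1) ≤
      ENNReal.ofReal (6 * ρ) := by
  have hq0 : (0:ℝ) < q := by exact_mod_cast hq
  have hq1 : (1:ℝ) ≤ q := by exact_mod_cast hq
  have hsub : {x : ℝ | |q * x - 13/16 - round (q * x - 13/16)| < ρ} ∩ Set.Icc 0 1 ⊆
      ⋃ k ∈ Finset.range (q + 2), Set.Icc ((13/16 + (k - 1 : ℝ) - ρ) / q) ((13/16 + (k - 1 : ℝ) + ρ) / q) := by
    rintro x ⟨hx, h0, h1⟩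
    simp only [Set.mem_ofPred_eq] at hx
    have hx' := abs_lt.1 hx
    set m := round (q * x - 13/16) with hm
    have hr := abs_le.1 (abs_sub_round (q * x - 13/16))
    rw [← hm] at hr
    have hqx : 0 ≤ q * x := by positivity
    have hqx1 : q * x ≤ q := by nlinarith
    have m0 : -1 ≤ m := by
      have : (-2:ℝ) < m := by linarith
      have : (-2:ℤ) < m := by exact_mod_cast this
      omega
    have m1 : m ≤ q := by
      have : (m:ℝ) < q + 1 := by linarith
      have : m < q + 1 := by exact_mod_cast this
      omega
    have hmc : (((m + 1).toNat : ℕ) : ℝ) = m + 1 := by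
      exact_mod_cast congrArg (Int.cast (R := ℝ)) (Int.toNat_of_nonneg (by omega : 0 ≤ m + 1))
    simp only [Set.mem_iUnion, Finset.mem_range]
    refine ⟨(m + 1).toNat, by omega, ?_⟩
    rw [Set.mem_Icc, hmc, div_le_iff₀ hq0, le_div_iff₀ hq0]
    constructor <;> nlinarith [hx'.1, hx'.2]
  refine (measure_mono hsub).trans ((measure_biUnion_finset_le _ _).trans ?_)
  simp only [Real.volume_Icc]
  have e : ∀ k : ℕ, (13/16 + ((k:ℝ) - 1) + ρ) / q - (13/16 + ((k:ℝ) - 1) - ρ) / q = 2 * ρ / q := by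
    intro k; field_simp; ring
  simp only [e, Finset.sum_const, Finset.card_range, nsmul_eq_mul]
  rw [← ENNReal.ofReal_natCast, ← ENNReal.ofReal_mul (by positivity)]
  apply ENNReal.ofReal_le_ofReal
  push_cast
  rw [mul_div_assoc', div_le_iff₀ hq0]
  nlinarith
end Part7

open MeasureTheory Filter Topology
open scoped ENNReal
section Part8
set_option linter.unusedVariables false
set_option linter.unusedSimpArgs false

lemma Jf_per (H : ℝ × ℝ → ℝ × ℝ) (f : ℝ × ℝ → ℝ) (hf : Biper f) (hH : IntEquivariant H) (y : ℝ) :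
    Jf H f (y + 1) = Jf H f y := by
  unfold Jf
  congr 1; ext x
  exact (hf.comp_eqv hH).snd x y

lemma Jf_bd (H : ℝ × ℝ → ℝ × ℝ) (f : ℝ × ℝ → ℝ) (C : ℝ) (hC : ∀ p, |f p| ≤ C) (y : ℝ) :
    |Jf H f y| ≤ C := by
  have := intervalIntegral.norm_integral_le_of_norm_le_const (a := 0) (b := 1)
      (f := fun x => f (H (x, y))) (C := C) (fun x _ => hC _)
  simpa [Jf] using this

lemma Jf_mod (H : ℝ × ℝ → ℝ × ℝ) (f : ℝ × ℝ → ℝ) (hf : UniformContinuous fun p => f (H p))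
    (ε : ℝ) (hε : 0 < ε) :
    ∀ᶠ w : ℝ in 𝓝[>] 0, ∀ u v, |u - v| ≤ w → |Jf H f u - Jf H f v| ≤ ε := by
  obtain ⟨δ, hδ, hm⟩ := Metric.uniformContinuous_iff.1 hf ε hε
  have hc := hf.continuous
  have : ∀ᶠ w : ℝ in 𝓝[>] 0, w < δ := nhdsWithin_le_nhds (gt_mem_nhds hδ)
  filter_upwards [this] with w hw u v huv
  unfold Jf
  rw [← intervalIntegral.integral_sub
    (Continuous.intervalIntegrable (u := fun x => f (H (x, u))) (hc.comp (by fun_prop : Continuous fun x : ℝ => (x, u))) _ _)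
    (Continuous.intervalIntegrable (u := fun x => f (H (x, v))) (hc.comp (by fun_prop : Continuous fun x : ℝ => (x, v))) _ _)]
  have := intervalIntegral.norm_integral_le_of_norm_le_const (a := 0) (b := 1)
      (f := fun x => f (H (x, u)) - f (H (x, v))) (C := ε) (by
        intro x _
        have : dist ((x, u) : ℝ × ℝ) (x, v) < δ := by
          rw [Prod.dist_eq]
          simp only [dist_self, Real.dist_eq]
          exact max_lt hδ (huv.trans_lt hw)
        have := hm this
        rw [Real.dist_eq] at this
        exact this.le)
  simpa using this

lemma Jf_cont (H : ℝ × ℝ → ℝ × ℝ) (f : ℝ × ℝ → ℝ) (hf : UniformContinuous fun p => f (H p)) :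
    Continuous (Jf H f) := by
  rw [Metric.continuous_iff]
  intro b ε hε
  obtain ⟨w, hw, hw0⟩ := ((Jf_mod H f hf (ε / 2) (by linarith)).and self_mem_nhdsWithin).exists
  refine ⟨w, hw0, fun a ha => ?_⟩
  rw [Real.dist_eq] at *
  linarith [hw a b ha.le]

/-- the part of the step where the new denominator is chosen -/
lemma step_choose_l (D : ℕ) (hD : 2 ≤ D) (fs : ℕ → ℝ × ℝ → ℝ) (huc : ∀ j, UniformContinuous (fs j))
    (hbp : ∀ j, Biper (fs j)) (n : ℕ) (l : ℕ) (a : ℝ) (p : ℤ) (ha : a = p / (D ^ l : ℕ))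
    (hp : IsCoprime p (D ^ l : ℕ)) (H' K' : ℝ × ℝ → ℝ × ℝ) (hg : Good H' K') (ε : ℝ) (hε : 0 < ε) :
    ∃ l' : ℕ, ∃ β : ℝ, l < l' ∧ 0 < β ∧ β = 1 / (D ^ l' : ℕ) ∧
      (∃ p' : ℤ, a + β = p' / (D ^ l' : ℕ) ∧ IsCoprime p' (D ^ l' : ℕ)) ∧
      (∀ k ≤ n, ∀ p, ‖iteratedFDeriv ℝ k (fun p => H' ((K' p).1 + (a + β), (K' p).2) -
          H' ((K' p).1 + a, (K' p).2)) p‖ ≤ (1/2) ^ n) ∧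
      (∀ k ≤ n, ∀ p, ‖iteratedFDeriv ℝ k (fun p => H' ((K' p).1 + (-a + -β), (K' p).2) -
          H' ((K' p).1 + -a, (K' p).2)) p‖ ≤ (1/2) ^ n) ∧
      (∀ i : ℕ, i ≤ (n + 1) * D ^ l → ∀ x y : ℝ,
        dist (H' (x + i * (a + β), y)) (H' (x + i * a, y)) ≤ (1/2) ^ n) ∧
      (∀ j < n + 1, ∀ x y, |((D ^ l' : ℕ) : ℝ)⁻¹ * ∑ r ∈ Finset.range (D ^ l'),
        fs j (H' (x + r / (D ^ l' : ℕ), y)) - Jf H' (fs j) y| ≤ (1/2) ^ (n + 1)) ∧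
      (∀ j < n, ∀ u v : ℝ, |u - v| ≤ (D ^ l : ℕ) * β →
        |fs j (H' (u, 0)) - fs j (H' (v, 0))| ≤ ε) := by
  obtain ⟨L, hL⟩ := hg.lip
  have hDr : (1:ℝ) < D := by exact_mod_cast hD
  have t0 : Tendsto (fun l' : ℕ => D ^ l') atTop atTop := tendsto_pow_atTop_atTop_of_one_lt hD
  have t1 : Tendsto (fun l' : ℕ => 1 / ((D ^ l' : ℕ) : ℝ)) atTop (𝓝 0) := by
    simp only [one_div]
    exact tendsto_inv_atTop_zero.comp (tendsto_natCast_atTop_atTop.comp t0)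
  have t2 : Tendsto (fun l' : ℕ => -(1 / ((D ^ l' : ℕ) : ℝ))) atTop (𝓝 0) := by
    simpa using t1.neg
  have huc' : ∀ j, UniformContinuous fun p => fs j (H' p) := fun j => (huc j).comp hL.uniformContinuous
  have E1 : ∀ᶠ l' : ℕ in atTop, ∀ k ∈ Finset.range (n + 1), ∀ p,
      ‖iteratedFDeriv ℝ k (fun p => H' ((K' p).1 + (a + 1 / (D ^ l' : ℕ)), (K' p).2) -
          H' ((K' p).1 + a, (K' p).2)) p‖ ≤ (1/2) ^ n := by
    rw [Finset.eventually_all]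
    intro k _
    exact t1.eventually (ck_close hg a k ((1/2) ^ n) (by positivity))
  have E2 : ∀ᶠ l' : ℕ in atTop, ∀ k ∈ Finset.range (n + 1), ∀ p,
      ‖iteratedFDeriv ℝ k (fun p => H' ((K' p).1 + (-a + -(1 / (D ^ l' : ℕ))), (K' p).2) -
          H' ((K' p).1 + -a, (K' p).2)) p‖ ≤ (1/2) ^ n := by
    rw [Finset.eventually_all]
    intro k _
    exact t2.eventually (ck_close hg (-a) k ((1/2) ^ n) (by positivity))
  have E3 : ∀ᶠ l' : ℕ in atTop, L * (((n + 1) * D ^ l : ℕ) * (1 / ((D ^ l' : ℕ) : ℝ))) < (1/2) ^ n := by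
    have := (t1.const_mul ((((n + 1) * D ^ l : ℕ) : ℝ))).const_mul (L : ℝ)
    rw [mul_zero, mul_zero] at this
    exact this.eventually (gt_mem_nhds (by positivity))
  have E4 : ∀ᶠ l' : ℕ in atTop, ∀ j ∈ Finset.range (n + 1), ∀ x y,
      |((D ^ l' : ℕ) : ℝ)⁻¹ * ∑ r ∈ Finset.range (D ^ l'),
        fs j (H' (x + r / (D ^ l' : ℕ), y)) - Jf H' (fs j) y| ≤ (1/2) ^ (n + 1) := by
    rw [Finset.eventually_all]
    intro j _
    exact t0.eventually (riemann (fun p => fs j (H' p)) (huc' j) ((hbp j).comp_eqv hg.eqv)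
      ((1/2) ^ (n + 1)) (by positivity))
  have E5 : ∀ᶠ l' : ℕ in atTop, ∀ j ∈ Finset.range n, ∀ u v : ℝ,
      |u - v| ≤ (D ^ l : ℕ) * (1 / ((D ^ l' : ℕ) : ℝ)) →
        |fs j (H' (u, 0)) - fs j (H' (v, 0))| ≤ ε := by
    rw [Finset.eventually_all]
    intro j _
    obtain ⟨δ, hδ, hm⟩ := Metric.uniformContinuous_iff.1 (huc' j) ε hε
    have := t1.const_mul (((D ^ l : ℕ) : ℝ))
    rw [mul_zero] at this
    filter_upwards [this.eventually (gt_mem_nhds hδ)] with l' hl u v huv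
    have h1 : dist ((u, 0) : ℝ × ℝ) (v, 0) < δ := by
      rw [Prod.dist_eq]
      simp only [dist_self, Real.dist_eq]
      exact max_lt (huv.trans_lt hl) hδ
    have := hm h1
    rw [Real.dist_eq] at this
    exact this.le
  obtain ⟨l', e1, e2, e3, e4, e5, hl⟩ :=
    (E1.and (E2.and (E3.and (E4.and (E5.and (eventually_gt_atTop l)))))).exists
  have hpos : (0:ℝ) < (D ^ l' : ℕ) := by positivity
  have hpos0 : (0:ℝ) < (D ^ l : ℕ) := by positivity
  refine ⟨l', 1 / (D ^ l' : ℕ), hl, by positivity, rfl, ?_, ?_, ?_, ?_, ?_, ?_⟩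
  · refine ⟨p * D ^ (l' - l) + 1, ?_, ?_⟩
    · rw [ha]
      have : ((D ^ l' : ℕ) : ℝ) = (D ^ l : ℕ) * D ^ (l' - l) := by
        push_cast; rw [← pow_add]; congr 1; omega
      rw [this]
      push_cast
      have hDp : (D:ℝ) ≠ 0 := by positivity
      field_simp
    · have : IsCoprime (p * (D:ℤ) ^ (l' - l) + 1) (D : ℤ) := by
        obtain ⟨m, hm⟩ : ∃ m, l' - l = m + 1 := ⟨l' - l - 1, by omega⟩
        refine ⟨1, -(p * D ^ m), ?_⟩
        rw [hm]; ring
      push_cast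
      exact this.pow_right
  · intro k hk; exact e1 k (Finset.mem_range.2 (by omega))
  · intro k hk; exact e2 k (Finset.mem_range.2 (by omega))
  · intro i hi x y
    refine (hL.dist_le_mul _ _).trans (le_trans ?_ e3.le)
    gcongr
    rw [Prod.dist_eq]
    simp only [dist_self, Real.dist_eq]
    have : x + i * (a + 1 / ((D ^ l' : ℕ) : ℝ)) - (x + i * a) = i * (1 / ((D ^ l' : ℕ) : ℝ)) := by ring
    rw [this, abs_of_nonneg (by positivity)]
    apply max_le _ (by positivity)
    gcongr
  · intro j hj; exact e4 j (Finset.mem_range.2 hj)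
  · intro j hj; exact e5 j (Finset.mem_range.2 hj)
end Part8

open MeasureTheory Filter Topology
open scoped ENNReal
section Part9
set_option linter.unusedVariables false
set_option linter.unusedSimpArgs false

lemma exists_params (n : ℕ) (C : ℕ → ℝ) : ∃ κ : ℝ, ∃ L : ℕ, 0 < κ ∧ κ < 1/16 ∧ 0 < L ∧
    ∀ j < n, 8 * (4 * C j * κ + (1/2)^n / 32 + 2 * C j / L) ≤ 3/4 * (1/2) ^ n := by
  obtain ⟨B, hB, hB1⟩ : ∃ B : ℝ, (∀ j < n, C j ≤ B) ∧ 1 ≤ B := by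
    refine ⟨∑ j ∈ Finset.range n, |C j| + 1, fun j hj => ?_, ?_⟩
    · have := Finset.single_le_sum (f := fun j => |C j|) (fun i _ => abs_nonneg _) (Finset.mem_range.2 hj)
      linarith [le_abs_self (C j)]
    · have := Finset.sum_nonneg (s := Finset.range n) (f := fun j => |C j|) (fun i _ => abs_nonneg _)
      linarith
  obtain ⟨e, he, he1⟩ : ∃ e : ℝ, e = (1/2) ^ n ∧ 0 < e := ⟨_, rfl, by positivity⟩
  have he2 : e ≤ 1 := by rw [he]; exact pow_le_one₀ (by norm_num) (by norm_num)
  obtain ⟨L, hL⟩ := exists_nat_gt (64 * B / e)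
  have hL0 : (0:ℝ) < L := lt_trans (by positivity) hL
  refine ⟨e / (128 * B), L, by positivity, ?_, by exact_mod_cast hL0, ?_⟩
  · rw [div_lt_iff₀ (by positivity)]; nlinarith
  · intro j hj
    have hj' := hB j hj
    rw [← he]
    have h1 : 4 * C j * (e / (128 * B)) ≤ e / 32 := by
      calc 4 * C j * (e / (128 * B)) ≤ 4 * B * (e / (128 * B)) := by gcongr
        _ = e / 32 := by field_simp; ring
    have h2 : 2 * C j / L ≤ e / 32 := by
      rw [div_lt_iff₀ he1] at hL
      rw [div_le_iff₀ hL0]; nlinarith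
    linarith

set_option maxHeartbeats 2000000 in
lemma exists_step (α : ℝ) (hα : 1 < α) (D : ℕ) (hD : 2 ≤ D) (fs : ℕ → ℝ × ℝ → ℝ)
    (huc : ∀ j, UniformContinuous (fs j)) (hbp : ∀ j, Biper (fs j)) (C : ℕ → ℝ)
    (hC : ∀ j p, |fs j p| ≤ C j) (n : ℕ) (S : St) (hv : Valid D fs n S) :
    ∃ S', Valid D fs (n + 1) S' ∧ Step α D fs C n S S' := by
  obtain ⟨H, K, a, l, w0⟩ := S
  obtain ⟨hg, ⟨p, ha, hp⟩, hw0, havg⟩ := hv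
  simp only at hg ha hp hw0 havg
  obtain ⟨q, hqd⟩ : ∃ q : ℕ, q = D ^ l := ⟨_, rfl⟩
  have hq : 0 < q := by rw [hqd]; positivity
  have hq0 : (0:ℝ) < q := by exact_mod_cast hq
  obtain ⟨κ, L, hκ, hκ2, hL, hpar⟩ := exists_params n C
  set ε : ℝ := (1/2) ^ n / 32 with hε
  have hε0 : 0 < ε := by positivity
  have h2n : (0:ℝ) < (1/2) ^ n := by positivity
  -- column width
  obtain ⟨KH, hKH⟩ := hg.lip
  have hposf : ∀ᶠ ρ : ℝ in 𝓝[>] 0, 0 < ρ := self_mem_nhdsWithin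
  have hlt : ∀ b : ℝ, 0 < b → ∀ᶠ ρ : ℝ in 𝓝[>] 0, ρ < b := fun b hb =>
    nhdsWithin_le_nhds (gt_mem_nhds hb)
  obtain ⟨ρ, hρ0, hρ1, hρ2, hρS⟩ := (hposf.and ((hlt (3/16) (by norm_num)).and
    ((hlt ((1/2) ^ (n + 4) / 6) (by positivity)).and
    (small_strip α hα q hq (13/16) (fun p => torusProj (H p))
      (torusProj_biper.comp_eqv hg.eqv) (1 * KH) (torusProj_lip.comp hKH) ((1/2) ^ n) (by positivity))))).exists
  obtain ⟨G, hGc, hGp, hex⟩ := exists_G_h q hq κ hκ hκ2 L (8 * ρ / 3) (by linarith) (by linarith)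
  have hvG := hg.comp (Good.vshear G hGc hGp)
  obtain ⟨KG, hKG⟩ := hvG.lip
  have hsw : LipschitzWith 1 (Prod.swap : ℝ × ℝ → ℝ × ℝ) := LipschitzWith.of_dist_le_mul (by
    intro x y
    simp [Prod.dist_eq, max_comm])
  have hbsw : Biper (fun p : ℝ × ℝ => torusProj (H (p.swap.1, p.swap.2 + G p.swap.1))) := by
    intro p m
    have := (torusProj_biper.comp_eqv hvG.eqv) p.swap (m.2, m.1)
    simpa using this
  have W1 := small_strip α hα 1 one_pos 0
    (fun p : ℝ × ℝ => torusProj (H (p.swap.1, p.swap.2 + G p.swap.1))) hbsw (1 * KG * 1)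
    ((torusProj_lip.comp hKG).comp hsw) ((1/2) ^ n) (by positivity)
  have t2 : Tendsto (fun w : ℝ => 2 * w) (𝓝[>] 0) (𝓝[>] 0) := by
    refine tendsto_nhdsWithin_iff.2 ⟨?_, ?_⟩
    · have : Tendsto (fun w : ℝ => 2 * w) (𝓝 0) (𝓝 (2 * 0)) :=
        (continuous_const.mul continuous_id).tendsto 0
      rw [mul_zero] at this
      exact this.mono_left nhdsWithin_le_nhds
    · filter_upwards [hposf] with w hw
      simp only [Set.mem_Ioi] at *; linarith
  have hucH : ∀ j, UniformContinuous fun p => fs j (H p) := fun j => (huc j).comp hKH.uniformContinuous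
  have W2 : ∀ᶠ w : ℝ in 𝓝[>] 0, ∀ j ∈ Finset.range n, ∀ u v, |u - v| ≤ w →
      |Jf H (fs j) u - Jf H (fs j) v| ≤ ε := by
    rw [Finset.eventually_all]
    exact fun j _ => Jf_mod H (fs j) (hucH j) ε hε0
  obtain ⟨w, hwpos, hw8, hww, hwJ, hwS⟩ := (hposf.and ((hlt (1/8) (by norm_num)).and
    ((hlt (w0 / 8) (by linarith)).and (W2.and (t2.eventually W1))))).exists
  obtain ⟨h, k, hgh, hcomm, hfix, hramp, hfar, hband⟩ := hex w hwpos hw8.le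
  have hg' := hg.comp hgh
  obtain ⟨l', β, hl, hβ, hβd, ⟨p', hp'1, hp'2⟩, hck, hcki, hclose, havg', hmod⟩ :=
    step_choose_l D hD fs huc hbp n l a p ha hp _ _ hg' ε hε0
  -- T_n in terms of the new conjugacy
  have haq : a = (p:ℝ) / q := by rw [ha, hqd]
  have hTn : ∀ pt, H (h ((k (K pt)).1 + a, (k (K pt)).2)) = H ((K pt).1 + a, (K pt).2) := by
    intro pt
    have := hcomm p (k (K pt)).1 (k (K pt)).2
    rw [haq, this, Prod.mk.eta, hgh.right]
  have hTin : ∀ pt, H (h ((k (K pt)).1 + -a, (k (K pt)).2)) = H ((K pt).1 - a, (K pt).2) := by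
    intro pt
    have := hcomm (-p) (k (K pt)).1 (k (K pt)).2
    rw [haq, show -((p:ℝ) / q) = ((-p : ℤ) : ℝ) / q by push_cast; ring, this, Prod.mk.eta, hgh.right]
    push_cast
    congr 2; ring
  -- Lemma B data
  set Y : ℝ → ℝ := fun s => (h (s / q, 0)).2 with hY
  have hhc := hgh.cd.continuous
  have hYc : Continuous Y := by fun_prop
  have hYp : ∀ s, Y (s + 1) = Y s := by
    intro s
    simp only [hY]
    have := hcomm 1 (s / q) 0
    rw [show (s + 1) / (q:ℝ) = s / q + ((1:ℤ):ℝ) / q by push_cast; ring, this]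
  have hY0 : ∀ s, 0 ≤ s → s ≤ 5/8 → Y s = 0 := by
    intro s h0 h1
    have e : (q:ℝ) * (s / q) = s := by field_simp
    have := hfix (s / q) (by rw [e, Int.fract_eq_self.2 ⟨h0, by linarith⟩]; exact h1)
    simp only [hY, this]
  have hGc' : ∀ j, Continuous fun x : ℝ => fs j (H (h (x, 0))) := by
    intro j
    have h1 := (huc j).continuous
    have h2 := hg.cd.continuous
    fun_prop
  have hGper : ∀ j, ∀ x : ℝ, fs j (H (h (x + 1, 0))) = fs j (H (h (x, 0))) := fun j x =>
    ((hbp j).comp_eqv hg'.eqv).fst x 0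
  have hΨ : ∀ j < n, ∀ x : ℝ, |(q : ℝ)⁻¹ * ∑ r ∈ Finset.range q, fs j (H (h (x + r / q, 0))) -
      Jf H (fs j) (Y (q * x))| ≤ (1/2) ^ n := by
    intro j hj x
    have e : (q:ℝ) * x / q = x := by field_simp
    simp only [hY, e]
    have e2 : ∀ r : ℕ, h (x + r / q, 0) = ((h (x, 0)).1 + r / q, (h (x, 0)).2) := fun r => by
      simpa using hcomm r x 0
    simp only [e2]
    have := havg j hj (h (x, 0)).1 (h (x, 0)).2
    rw [← hqd] at this
    exact this
  have hB : ∀ j < n, _ := fun j hj => lemB (Jf H (fs j)) Y (Jf_cont H (fs j) (hucH j))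
    (Jf_per H (fs j) (hbp j) hg.eqv) hYc hYp (C j) κ ε w L hL hκ hκ2 (Jf_bd H (fs j) (C j) (hC j))
    (hwJ j (Finset.mem_range.2 hj)) hε0.le hY0 hramp (I2 (fs j))
    (hg.pres (fs j) (huc j).continuous (hbp j)).symm _ rfl
  have hJYc : ∀ j, Continuous fun s => Jf H (fs j) (Y s) := fun j => (Jf_cont H (fs j) (hucH j)).comp hYc
  have hJYp : ∀ j, ∀ s, Jf H (fs j) (Y (s + 1)) = Jf H (fs j) (Y s) := fun j s => by rw [hYp]
  refine ⟨⟨fun x => H (h x), fun x => k (K x), a + β, l', w⟩, ⟨hg', ⟨p', hp'1, hp'2⟩, hwpos, havg'⟩, ?_⟩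
  refine ⟨hl, hww.le, hw8.le, ?_, ?_, ?_, ?_, ?_, ?_, ?_⟩
  · intro m hm pt
    have := hck m hm pt
    simp only [hTn] at this
    exact this
  · intro m hm pt
    have := hcki m hm pt
    simp only [hTin] at this
    have e : ∀ x : ℝ, x + (-a + -β) = x - (a + β) := fun x => by ring
    simp only [e] at this
    exact this
  · intro i hi pt
    have e1 := St.iter ⟨fun x => H (h x), fun x => k (K x), a + β, l', w⟩ hg' i pt
    have hTeq : (⟨H, K, a, l, w0⟩ : St).T = (⟨fun x => H (h x), fun x => k (K x), a, l', w⟩ : St).T := by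
      ext1 pt; exact (hTn pt).symm
    have e2 := St.iter ⟨fun x => H (h x), fun x => k (K x), a, l', w⟩ hg' i pt
    rw [hTeq, e1, e2]
    exact hclose i hi _ _
  · intro j hj
    have h1 := step3a _ _ (hGc' j) (hGper j) (hJYc j) (hJYp j) q hq _ (hΨ j hj)
    have h2 := (hB j hj).1
    have h3 := hpar j hj
    have h4 : Jf (fun x => H (h x)) (fs j) 0 = ∫ x in (0:ℝ)..1, fs j (H (h (x, 0))) := rfl
    simp only [h4]
    refine (abs_sub_le _ _ _).trans ((add_le_add h1 h2).trans ?_)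
    linarith
  · intro j hj x hx N
    simp only at hx ⊢
    rw [← hqd] at hx ⊢
    have h1 := step3b _ _ (hGc' j) (hGper j) (hJYc j) (hJYp j) q hq _ (hΨ j hj) (C j) ε β
      (fun x => hC j _) p (by rw [hqd]; exact hp) hβ (by rw [hqd]; exact hmod j hj) (I2 (fs j)) _ (hB j hj).2 x hx N
    rw [← haq] at h1
    refine h1.trans ?_
    have h3 := hpar j hj
    have : (0:ℝ) ≤ N := Nat.cast_nonneg _
    have h4 : |Jf H (fs j) 0 - I2 (fs j)| + 8 * (4 * C j * κ + ε + 2 * C j / L) + (1/2) ^ n + 2 * ε ≤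
      |Jf H (fs j) 0 - I2 (fs j)| + 2 * (1/2) ^ n := by linarith
    have := mul_le_mul_of_nonneg_left h4 this
    linarith
  · intro x hx
    simp only at hx ⊢
    rw [← hqd] at hx
    rw [hfix x (by linarith)]
  · refine ⟨h, {x | |q * x - 13/16 - round (q * x - 13/16)| < ρ}, ?_, ?_, fun _ => rfl,
      fun pt => hgh.right _, ?_, ?_, ?_⟩
    · apply measurableSet_lt _ measurable_const
      have : Measurable fun x : ℝ => ((round (q * x - 13/16) : ℤ) : ℝ) := by
        simp only [round_eq]
        exact (measurable_from_top (f := (Int.cast : ℤ → ℝ))).comp (Int.measurable_floor.comp (by fun_prop))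
      have h2 : Measurable fun x : ℝ => q * x - 13/16 - ((round (q * x - 13/16) : ℤ) : ℝ) :=
        Measurable.sub (by fun_prop) this
      exact h2.abs
    · exact (col_vol q hq ρ hρ0).trans (ENNReal.ofReal_le_ofReal (by linarith))
    · refine hρS.mono (Set.image_mono ?_)
      intro pt hpt
      simp only [Set.mem_ofPred_eq] at hpt ⊢
      exact hpt.le
    · refine hwS.mono ?_
      rintro _ ⟨⟨x, y⟩, hy, rfl⟩
      simp only [Set.mem_ofPred_eq] at hy
      obtain ⟨x', y', h1, h2⟩ := hband x y hy
      refine ⟨(y', x'), ?_, ?_⟩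
      · simpa using h1
      · simp only [Prod.swap_prod_mk, h2]
    · intro x y hy
      obtain ⟨h1, h2⟩ := hfar x y hy
      refine ⟨h1, fun hx => h2 ?_⟩
      simp only [Set.mem_ofPred_eq, not_lt] at hx
      linarith
end Part9

open MeasureTheory Filter Topology
open scoped ENNReal
section Part10
set_option linter.unusedVariables false
set_option linter.unusedSimpArgs false

lemma Biper.uc {f : ℝ × ℝ → ℝ} (hf : Biper f) (hc : Continuous f) : UniformContinuous f := by
  have hk : IsCompact (Set.Icc (-1:ℝ) 2 ×ˢ Set.Icc (-1:ℝ) 2) := isCompact_Icc.prod isCompact_Icc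
  have hu := hk.uniformContinuousOn_of_continuous hc.continuousOn
  rw [Metric.uniformContinuousOn_iff] at hu
  rw [Metric.uniformContinuous_iff]
  intro ε hε
  obtain ⟨δ, hδ, h⟩ := hu ε hε
  refine ⟨min δ 1, lt_min hδ one_pos, ?_⟩
  intro a b hab
  obtain ⟨a0, ha0, m, rfl⟩ := exists_square a
  have hab' : dist a0 (b - ((m.1:ℝ), (m.2:ℝ))) < min δ 1 := by
    have : dist a0 (b - ((m.1:ℝ), (m.2:ℝ))) = dist (a0 + ((m.1:ℝ), (m.2:ℝ))) b := by
      rw [dist_eq_norm, dist_eq_norm]; congr 1; abel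
    rw [this]; exact hab
  have e2 : f b = f (b - ((m.1:ℝ), (m.2:ℝ))) := by
    have := hf (b - ((m.1:ℝ), (m.2:ℝ))) m
    rw [← this]; congr 1; abel
  rw [hf a0 m, e2]
  have h1 : dist a0.1 (b - ((m.1:ℝ), (m.2:ℝ))).1 < 1 := by
    refine lt_of_le_of_lt ?_ (hab'.trans_le (min_le_right _ _)); rw [Prod.dist_eq]; exact le_max_left _ _
  have h2 : dist a0.2 (b - ((m.1:ℝ), (m.2:ℝ))).2 < 1 := by
    refine lt_of_le_of_lt ?_ (hab'.trans_le (min_le_right _ _)); rw [Prod.dist_eq]; exact le_max_right _ _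
  rw [Real.dist_eq, abs_lt] at h1 h2
  obtain ⟨⟨a1, a2⟩, ⟨a3, a4⟩⟩ := ha0
  apply h
  · exact ⟨⟨by linarith, by linarith⟩, ⟨by linarith, by linarith⟩⟩
  · exact ⟨⟨by linarith, by linarith⟩, ⟨by linarith, by linarith⟩⟩
  · exact hab'.trans_le (min_le_left _ _)

lemma I2_close (g g' : ℝ × ℝ → ℝ) (hg : Continuous g) (hg' : Continuous g') (ε : ℝ)
    (h : ∀ p, |g p - g' p| ≤ ε) : |I2 g - I2 g'| ≤ ε := by
  have c1 : ∀ u : ℝ × ℝ → ℝ, Continuous u → Continuous (fun y : ℝ => ∫ x in (0:ℝ)..1, u (x, y)) := by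
    intro u hu
    apply intervalIntegral.continuous_parametric_intervalIntegral_of_continuous'
    simp only [Function.uncurry_def]; fun_prop
  unfold I2
  rw [← intervalIntegral.integral_sub ((c1 g hg).intervalIntegrable _ _) ((c1 g' hg').intervalIntegrable _ _)]
  have := intervalIntegral.norm_integral_le_of_norm_le_const (a := 0) (b := 1) (C := ε)
    (f := fun y => (∫ x in (0:ℝ)..1, g (x, y)) - ∫ x in (0:ℝ)..1, g' (x, y)) ?_
  · simpa using this
  · intro y hy
    rw [← intervalIntegral.integral_sub (Continuous.intervalIntegrable (by fun_prop) _ _)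
      (Continuous.intervalIntegrable (by fun_prop) _ _)]
    have := intervalIntegral.norm_integral_le_of_norm_le_const (a := 0) (b := 1) (C := ε)
      (f := fun x => g (x, y) - g' (x, y)) (fun x _ => h (x, y))
    simpa using this

lemma smooth_lim (F : ℕ → ℝ × ℝ → ℝ × ℝ) (hF : ∀ n, ContDiff ℝ (⊤ : ℕ∞) (F n))
    (h : ∀ n k, k ≤ n → ∀ p, ‖iteratedFDeriv ℝ k (fun p => F (n+1) p - F n p) p‖ ≤ (1/2) ^ n) :
    ∃ G : ℝ × ℝ → ℝ × ℝ, ContDiff ℝ (⊤ : ℕ∞) G ∧ ∀ n p, dist (F n p) (G p) ≤ 2 * (1/2) ^ n := by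
  have hd : ∀ n p, ‖F (n+1) p - F n p‖ ≤ (1/2) ^ n := by
    intro n p
    have := h n 0 (Nat.zero_le _) p
    rwa [norm_iteratedFDeriv_zero] at this
  have hs : Summable (fun n : ℕ => ((1:ℝ)/2) ^ n) := summable_geometric_two
  have hsum : ∀ p, Summable (fun n => F (n+1) p - F n p) := fun p =>
    Summable.of_norm_bounded hs (fun n => hd n p)
  refine ⟨fun p => F 0 p + ∑' n, (F (n+1) p - F n p), ?_, ?_⟩
  · apply (hF 0).add
    apply contDiff_tsum_of_eventually (v := fun k n => (1/2) ^ n) (fun i => (hF (i+1)).sub (hF i))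
    · intro k hk; exact hs
    · intro k hk
      rw [Nat.cofinite_eq_atTop]
      filter_upwards [eventually_ge_atTop k] with n hn p using h n k hn p
  · intro n p
    have ht : Tendsto (fun m => F m p) atTop (𝓝 (F 0 p + ∑' n, (F (n+1) p - F n p))) := by
      have := ((hsum p).hasSum.tendsto_sum_nat).const_add (F 0 p)
      refine this.congr (fun m => ?_)
      rw [Finset.sum_range_sub (fun i => F i p)]; abel
    have := dist_le_of_le_geometric_of_tendsto (1/2) 1 (f := fun m => F m p) (by norm_num)
      (fun m => by rw [dist_comm, dist_eq_norm, one_mul]; exact hd m p) ht n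
    convert this using 1
    ring

lemma Good.lim (F Fi : ℕ → ℝ × ℝ → ℝ × ℝ) (hg : ∀ n, Good (F n) (Fi n)) (G Gi : ℝ × ℝ → ℝ × ℝ)
    (hG : ContDiff ℝ (⊤ : ℕ∞) G) (hGi : ContDiff ℝ (⊤ : ℕ∞) Gi)
    (h : ∀ n p, dist (F n p) (G p) ≤ 2 * (1/2) ^ n)
    (hi : ∀ n p, dist (Fi n p) (Gi p) ≤ 2 * (1/2) ^ n) : Good G Gi := by
  have h0 : Tendsto (fun n : ℕ => 2 * ((1:ℝ)/2) ^ n) atTop (𝓝 0) := by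
    simpa using (tendsto_pow_atTop_nhds_zero_of_lt_one (r := (1:ℝ)/2) (by norm_num) (by norm_num)).const_mul 2
  have ht : ∀ p, Tendsto (fun n => F n p) atTop (𝓝 (G p)) := fun p =>
    tendsto_iff_dist_tendsto_zero.2 (squeeze_zero (fun _ => dist_nonneg) (fun n => h n p) h0)
  have hti : ∀ p, Tendsto (fun n => Fi n p) atTop (𝓝 (Gi p)) := fun p =>
    tendsto_iff_dist_tendsto_zero.2 (squeeze_zero (fun _ => dist_nonneg) (fun n => hi n p) h0)
  refine ⟨hG, hGi, ?_, ?_, ?_, ?_, ?_⟩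
  · intro p m
    refine tendsto_nhds_unique (ht _) ?_
    simp only [fun n => (hg n).eqv p m]
    exact (ht p).add_const _
  · intro p m
    refine tendsto_nhds_unique (hti _) ?_
    simp only [fun n => (hg n).eqvK p m]
    exact (hti p).add_const _
  · intro p
    have h1 : Tendsto (fun n => Gi (F n p)) atTop (𝓝 (Gi (G p))) := (hGi.continuous.tendsto _).comp (ht p)
    refine tendsto_nhds_unique h1 (tendsto_iff_dist_tendsto_zero.2 (squeeze_zero (fun _ => dist_nonneg) (fun n => ?_) h0))
    have := hi n (F n p)
    rwa [(hg n).left, dist_comm] at this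
  · intro p
    have h1 : Tendsto (fun n => G (Fi n p)) atTop (𝓝 (G (Gi p))) := (hG.continuous.tendsto _).comp (hti p)
    refine tendsto_nhds_unique h1 (tendsto_iff_dist_tendsto_zero.2 (squeeze_zero (fun _ => dist_nonneg) (fun n => ?_) h0))
    have := h n (Fi n p)
    rwa [(hg n).right, dist_comm] at this
  · intro f hf hp
    have hu := hp.uc hf
    rw [Metric.uniformContinuous_iff] at hu
    apply eq_of_forall_dist_le
    intro ε hε
    obtain ⟨δ, hδ, hu⟩ := hu ε hε
    obtain ⟨n, hn⟩ := (h0.eventually_lt_const hδ).exists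
    rw [← (hg n).pres f hf hp, Real.dist_eq]
    apply I2_close _ _ (hf.comp hG.continuous) (hf.comp (hg n).cd.continuous)
    intro p
    rw [← Real.dist_eq, dist_comm]
    exact (hu ((h n p).trans_lt hn)).le

lemma iter_lim (F : ℕ → ℝ × ℝ → ℝ × ℝ) (G : ℝ × ℝ → ℝ × ℝ) (hG : Continuous G)
    (h : ∀ n p, dist (F n p) (G p) ≤ 2 * (1/2) ^ n) (i : ℕ) (p : ℝ × ℝ) :
    Tendsto (fun n => (F n)^[i] p) atTop (𝓝 (G^[i] p)) := by
  have h0 : Tendsto (fun n : ℕ => 2 * ((1:ℝ)/2) ^ n) atTop (𝓝 0) := by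
    simpa using (tendsto_pow_atTop_nhds_zero_of_lt_one (r := (1:ℝ)/2) (by norm_num) (by norm_num)).const_mul 2
  induction i with
  | zero => simp
  | succ i ih =>
    simp only [Function.iterate_succ_apply']
    have h1 := (hG.tendsto _).comp ih
    have h2 : Tendsto (fun n => dist (F n ((F n)^[i] p)) (G ((F n)^[i] p))) atTop (𝓝 0) :=
      squeeze_zero (fun _ => dist_nonneg) (fun n => h n _) h0
    exact (tendsto_iff_of_dist h2).2 h1

lemma iter_close (F : ℕ → ℝ × ℝ → ℝ × ℝ) (G : ℝ × ℝ → ℝ × ℝ) (hG : Continuous G)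
    (h : ∀ n p, dist (F n p) (G p) ≤ 2 * (1/2) ^ n) (M : ℕ → ℕ) (hM : Monotone M)
    (hc : ∀ n, ∀ i ≤ M n, ∀ p, dist ((F (n+1))^[i] p) ((F n)^[i] p) ≤ (1/2) ^ n)
    (n i : ℕ) (hi : i ≤ M n) (p : ℝ × ℝ) : dist (G^[i] p) ((F n)^[i] p) ≤ 2 * (1/2) ^ n := by
  have key : ∀ m, dist ((F (n+m))^[i] p) ((F n)^[i] p) ≤ 2 * (1/2) ^ n - 2 * (1/2) ^ (n+m) := by
    intro m
    induction m with
    | zero => simp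
    | succ m ih =>
      have := hc (n+m) i (hi.trans (hM (Nat.le_add_right _ _))) p
      refine (dist_triangle _ ((F (n+m))^[i] p) _).trans ?_
      have e : (2:ℝ) * (1/2) ^ (n+(m+1)) = (1/2)^(n+m) := by rw [← add_assoc, pow_succ]; ring
      rw [e, ← add_assoc]; linarith
  have ht := (iter_lim F G hG h i p).comp (tendsto_add_atTop_nat n)
  refine le_of_tendsto (ht.dist tendsto_const_nhds) (Eventually.of_forall fun m => ?_)
  have := key m
  have h1 : (0:ℝ) ≤ 2 * (1/2) ^ (n+m) := by positivity
  simp only [Function.comp]; rw [add_comm m n]; linarith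

lemma exists_seq (α : ℝ) (hα : 1 < α) (D : ℕ) (hD : 2 ≤ D) (fs : ℕ → ℝ × ℝ → ℝ)
    (huc : ∀ j, UniformContinuous (fs j)) (hbp : ∀ j, Biper (fs j)) (C : ℕ → ℝ)
    (hC : ∀ j p, |fs j p| ≤ C j) : ∃ S : ℕ → St, (∀ x y, (S 0).H (x, y) = (x, y)) ∧
      ∀ n, Valid D fs n (S n) ∧ Step α D fs C n (S n) (S (n+1)) := by
  have h0 : Valid D fs 0 ⟨fun p => p, fun p => p, 0, 0, 1⟩ := by
    refine ⟨Good.one, ⟨0, by simp, by simpa using isCoprime_one_right⟩, by simp, ?_⟩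
    intro j hj; omega
  choose nx hnx using exists_step α hα D hD fs huc hbp C hC
  let S : (n : ℕ) → {s : St // Valid D fs n s} := fun n =>
    Nat.rec (motive := fun n => {s : St // Valid D fs n s}) ⟨_, h0⟩ (fun n s => ⟨nx n s.1 s.2, (hnx n s.1 s.2).1⟩) n
  refine ⟨fun n => (S n).1, fun x y => rfl, fun n => ⟨(S n).2, (hnx n (S n).1 (S n).2).2⟩⟩

/-- descent to the torus -/
lemma torusProj_eq {p p' : ℝ × ℝ} (h : torusProj p = torusProj p') :
    ∃ m : ℤ × ℤ, p' = p + ((m.1:ℝ), (m.2:ℝ)) := by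
  have key : ∀ x y : ℝ, (x : UnitAddCircle) = (y : UnitAddCircle) → ∃ m : ℤ, y = x + m := by
    intro x y h
    have : ((y - x : ℝ) : UnitAddCircle) = 0 := by rw [AddCircle.coe_sub, h, sub_self]
    obtain ⟨m, hm⟩ := (AddCircle.coe_eq_zero_iff 1).1 this
    refine ⟨m, ?_⟩
    simp at hm; linarith
  simp only [torusProj, Prod.mk.injEq] at h
  obtain ⟨m1, h1⟩ := key _ _ h.1
  obtain ⟨m2, h2⟩ := key _ _ h.2
  exact ⟨(m1, m2), Prod.ext h1 h2⟩

lemma torusProj_oq : IsOpenQuotientMap torusProj := by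
  have h : IsOpenQuotientMap (fun x : ℝ => (x : UnitAddCircle)) := QuotientAddGroup.isOpenQuotientMap_mk
  exact h.prodMap h

/-- descend a function -/
def desc {X : Type*} (f : ℝ × ℝ → X) (z : Torus2) : X := f (Function.surjInv torusProj_oq.surjective z)

lemma desc_proj {X : Type*} {f : ℝ × ℝ → X} (hf : Biper f) (p : ℝ × ℝ) : desc f (torusProj p) = f p := by
  obtain ⟨m, hm⟩ := torusProj_eq (Function.surjInv_eq torusProj_oq.surjective (torusProj p))
  have h2 := hf (Function.surjInv torusProj_oq.surjective (torusProj p)) m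
  rw [← hm] at h2
  exact h2.symm

lemma desc_cont {X : Type*} [TopologicalSpace X] {f : ℝ × ℝ → X} (hf : Biper f) (hc : Continuous f) :
    Continuous (desc f) := by
  rw [← torusProj_oq.continuous_comp_iff]
  have : desc f ∘ torusProj = f := funext fun p => desc_proj hf p
  rwa [this]

lemma torus_int (g : Torus2 → ℝ) (hg : Continuous g) : ∫ z, g z = I2 (fun p => g (torusProj p)) := by
  rw [Measure.volume_eq_prod, integral_prod_symm]
  · have h1 : ∀ g : UnitAddCircle → ℝ, ∫ z, g z = ∫ x in (0:ℝ)..1, g (x : UnitAddCircle) := by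
      intro g
      have := UnitAddCircle.intervalIntegral_preimage 0 g
      simpa using this.symm
    simp only [h1]
    rfl
  · rw [← Measure.volume_eq_prod]
    exact hg.integrable_of_hasCompactSupport (HasCompactSupport.of_compactSpace _)

lemma Good.toTorus {H K : ℝ × ℝ → ℝ × ℝ} (h : Good H K) : ∃ τ : SmoothMPTorusDiffeo, τ.lift = H := by
  have b : ∀ {F : ℝ × ℝ → ℝ × ℝ}, IntEquivariant F → Biper (fun p => torusProj (F p)) := by
    intro F hF; exact torusProj_biper.comp_eqv hF
  have hs := torusProj_oq.surjective
  let e : Torus2 ≃ Torus2 :=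
    { toFun := desc (fun p => torusProj (H p))
      invFun := desc (fun p => torusProj (K p))
      left_inv := by
        intro z; obtain ⟨p, rfl⟩ := hs z
        rw [desc_proj (b h.eqv), desc_proj (b h.eqvK), h.left]
      right_inv := by
        intro z; obtain ⟨p, rfl⟩ := hs z
        rw [desc_proj (b h.eqvK), desc_proj (b h.eqv), h.right] }
  have hec : Continuous e := desc_cont (b h.eqv) (torusProj_oq.continuous.comp h.cd.continuous)
  refine ⟨⟨e, H, K, h.cd, h.cdK, h.eqv, h.eqvK, fun p => (desc_proj (b h.eqv) p).symm,
    fun p => (desc_proj (b h.eqvK) p).symm, ⟨hec.measurable, ?_⟩⟩, rfl⟩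
  have : IsFiniteMeasure (Measure.map e (volume : Measure Torus2)) := Measure.isFiniteMeasure_map _ _
  apply ext_of_forall_integral_eq_of_IsFiniteMeasure
  intro f
  rw [integral_map hec.measurable.aemeasurable f.continuous.aestronglyMeasurable]
  rw [torus_int (fun x => f (e x)) (f.continuous.comp hec), torus_int _ f.continuous]
  rw [← h.pres (fun p => f (torusProj p)) (f.continuous.comp torusProj_oq.continuous)
    (fun p m => congrArg f (torusProj_biper p m))]
  congr 1
  funext p
  exact congrArg f (desc_proj (b h.eqv) p)

lemma lift_iter (τ : SmoothMPTorusDiffeo) (i : ℕ) (p : ℝ × ℝ) :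
    τ.toEquiv^[i] (torusProj p) = torusProj (τ.lift^[i] p) := by
  induction i with
  | zero => rfl
  | succ i ih => rw [Function.iterate_succ_apply', Function.iterate_succ_apply', ih, τ.lift_isLift]

structure Sys (α : ℝ) (D : ℕ) (gs : ℕ → C(Torus2, ℝ)) (S : ℕ → St) (τ : SmoothMPTorusDiffeo) : Prop where
  dense : DenseRange gs
  zero : ∀ x y, (S 0).H (x, y) = (x, y)
  val : ∀ n, Valid D (fun j p => gs j (torusProj p)) n (S n)
  step : ∀ n, Step α D (fun j p => gs j (torusProj p)) (fun j => ‖gs j‖) n (S n) (S (n+1))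
  cl : ∀ n, ∀ i ≤ (n+1) * D ^ (S n).l, ∀ p, dist (τ.lift^[i] p) ((S n).T^[i] p) ≤ 2 * (1/2) ^ n

lemma cm_biper (g : C(Torus2, ℝ)) : Biper (fun p => g (torusProj p)) :=
  fun p m => congrArg g (torusProj_biper p m)

lemma cm_cont (g : C(Torus2, ℝ)) : Continuous (fun p => g (torusProj p)) :=
  g.continuous.comp torusProj_oq.continuous

lemma cm_uc (g : C(Torus2, ℝ)) : UniformContinuous (fun p => g (torusProj p)) :=
  (cm_biper g).uc (cm_cont g)

lemma exists_sys (α : ℝ) (hα : 1 < α) (D : ℕ) (hD : 2 ≤ D) :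
    ∃ gs S τ, Sys α D gs S τ := by
  obtain ⟨gs, hgs⟩ := TopologicalSpace.exists_dense_seq C(Torus2, ℝ)
  obtain ⟨S, h0, hS⟩ := exists_seq α hα D hD (fun j p => gs j (torusProj p)) (fun j => cm_uc _)
    (fun j => cm_biper _) (fun j => ‖gs j‖) (fun j p => (gs j).norm_coe_le_norm _)
  have hg : ∀ n, Good (S n).T (S n).Ti := fun n => (hS n).1.good.symm_rot (S n).a
  obtain ⟨G, hG, hGc⟩ := smooth_lim (fun n => (S n).T) (fun n => (hg n).cd) (fun n k hk p => (hS n).2.ck k hk p)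
  obtain ⟨Gi, hGi, hGic⟩ := smooth_lim (fun n => (S n).Ti) (fun n => (hg n).cdK) (fun n k hk p => (hS n).2.cki k hk p)
  obtain ⟨τ, hτ⟩ := (Good.lim _ _ hg G Gi hG hGi hGc hGic).toTorus
  refine ⟨gs, S, τ, hgs, h0, fun n => (hS n).1, fun n => (hS n).2, ?_⟩
  intro n i hi p
  rw [hτ]
  have hm : Monotone (fun n => (n+1) * D ^ (S n).l) := by
    apply monotone_nat_of_le_succ
    intro n
    exact Nat.mul_le_mul (by omega) (Nat.pow_le_pow_right (by omega) (hS n).2.llt.le)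
  exact iter_close (fun n => (S n).T) G hG.continuous hGc _ hm (fun n i hi p => (hS n).2.close i hi p) n i hi p

end Part10

open MeasureTheory Filter Topology
open scoped ENNReal
section Part11
set_option linter.unusedVariables false
set_option linter.unusedSimpArgs false

lemma dense_tendsto (gs : ℕ → C(Torus2, ℝ)) (hd : DenseRange gs) (A : ℕ → C(Torus2, ℝ) → ℝ) (L : C(Torus2, ℝ) → ℝ)
    (hA : ∀ N f g, |A N f - A N g| ≤ 2 * ‖f - g‖) (hL : ∀ f g, |L f - L g| ≤ 2 * ‖f - g‖)
    (h : ∀ j, Tendsto (fun N => A N (gs j)) atTop (𝓝 (L (gs j)))) (f : C(Torus2, ℝ)) :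
    Tendsto (fun N => A N f) atTop (𝓝 (L f)) := by
  rw [Metric.tendsto_atTop]
  intro ε hε
  obtain ⟨j, hj⟩ := hd.exists_dist_lt f (show 0 < ε / 8 by linarith)
  rw [dist_eq_norm] at hj
  obtain ⟨N0, hN0⟩ := Metric.tendsto_atTop.1 (h j) (ε/2) (by linarith)
  refine ⟨N0, fun N hN => ?_⟩
  have h1 := hN0 N hN
  have h2 := hA N f (gs j)
  have h3 := hL f (gs j)
  rw [Real.dist_eq] at *
  rw [abs_lt] at *
  rw [abs_le] at *
  constructor <;> linarith

lemma avg_lip (N : ℕ) (z : ℕ → Torus2) (f g : C(Torus2, ℝ)) :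
    |(N:ℝ)⁻¹ * ∑ i ∈ Finset.range N, f (z i) - (N:ℝ)⁻¹ * ∑ i ∈ Finset.range N, g (z i)| ≤ ‖f - g‖ := by
  rw [← mul_sub, ← Finset.sum_sub_distrib, abs_mul]
  rcases Nat.eq_zero_or_pos N with rfl | hN
  · simp
  have hN' : (0:ℝ) < N := by exact_mod_cast hN
  have : |∑ i ∈ Finset.range N, (f (z i) - g (z i))| ≤ N * ‖f - g‖ := by
    refine (Finset.abs_sum_le_sum_abs _ _).trans ?_
    refine (Finset.sum_le_card_nsmul _ _ ‖f - g‖ ?_).trans ?_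
    · intro i _; exact (f - g).norm_coe_le_norm (z i)
    · simp
  rw [abs_of_pos (inv_pos.2 hN'), inv_mul_le_iff₀ hN']
  exact this

lemma int_lip (f g : C(Torus2, ℝ)) : |(∫ z, f z) - ∫ z, g z| ≤ ‖f - g‖ := by
  rw [torus_int _ f.continuous, torus_int _ g.continuous]
  exact I2_close _ _ (cm_cont f) (cm_cont g) _ (fun p => (f - g).norm_coe_le_norm (torusProj p))

lemma contr_tendsto (u : ℕ → ℝ) (hu : ∀ n, 0 ≤ u n) (n0 : ℕ) (h : ∀ n, n0 ≤ n → u (n+1) ≤ 5/8 * u n) :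
    Tendsto u atTop (𝓝 0) := by
  rw [← tendsto_add_atTop_iff_nat n0]
  have hk : ∀ k, u (k + n0) ≤ (5/8)^k * u n0 := by
    intro k
    induction k with
    | zero => simp
    | succ k ih =>
      have := h (k+n0) (by omega)
      rw [show k + 1 + n0 = k + n0 + 1 by ring, pow_succ]
      linarith
  refine squeeze_zero (fun k => hu _) hk ?_
  simpa using (tendsto_pow_atTop_nhds_zero_of_lt_one (r := (5:ℝ)/8) (by norm_num) (by norm_num)).mul_const (u n0)

lemma Sys.e_tendsto {α D gs S τ} (h : Sys α D gs S τ) (j : ℕ) :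
    Tendsto (fun n => |Jf (S n).H (fun p => gs j (torusProj p)) 0 - I2 (fun p => gs j (torusProj p))|) atTop (𝓝 0) := by
  have h0 : Tendsto (fun n : ℕ => 16 * ((1:ℝ)/2) ^ n) atTop (𝓝 0) := by
    simpa using (tendsto_pow_atTop_nhds_zero_of_lt_one (r := (1:ℝ)/2) (by norm_num) (by norm_num)).const_mul 16
  have := (contr_tendsto (fun n => |Jf (S n).H (fun p => gs j (torusProj p)) 0 - I2 (fun p => gs j (torusProj p))|
    + 16 * (1/2) ^ n) (fun n => by positivity) (j+1) ?_).sub h0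
  · simpa using this
  · intro n hn
    have := (h.step n).e3a j (by omega)
    simp only [pow_succ] at *
    linarith

lemma Sys.fixed {α D gs S τ} (h : Sys α D gs S τ) (x : ℝ)
    (hx : ∀ l : ℕ, Int.fract (((D ^ l : ℕ) : ℝ) * x) ≤ 1/2) (n : ℕ) : (S n).K (x, 0) = (x, 0) := by
  have hH : ∀ n, (S n).H (x, 0) = (x, 0) := by
    intro n
    induction n with
    | zero => exact h.zero _ _
    | succ n ih => rw [(h.step n).fix x (hx _), ih]
  have := (h.val n).good.left (x, 0)
  rwa [hH] at this

lemma half_tendsto (c : ℝ) : Tendsto (fun n : ℕ => c * ((1:ℝ)/2) ^ n) atTop (𝓝 0) := by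
  simpa using (tendsto_pow_atTop_nhds_zero_of_lt_one (r := (1:ℝ)/2) (by norm_num) (by norm_num)).const_mul c

lemma sandwich_n (M : ℕ → ℕ) (hM : StrictMono M) (n2 N : ℕ) (hN : M n2 ≤ N) :
    ∃ n, n2 ≤ n ∧ M n ≤ N ∧ N ≤ M (n+1) := by
  have hex : ∃ n, N < M n := ⟨N+1, lt_of_lt_of_le (Nat.lt_succ_self N) (hM.le_apply)⟩
  classical
  have h1 := Nat.find_spec hex
  have h2 : n2 < Nat.find hex := by
    by_contra hc
    have := hM.monotone (not_lt.1 hc)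
    omega
  obtain ⟨m, hm⟩ : ∃ m, Nat.find hex = m + 1 := ⟨Nat.find hex - 1, by omega⟩
  refine ⟨m, by omega, ?_, ?_⟩
  · have := Nat.find_min hex (m := m) (by omega); omega
  · rw [hm] at h1; omega

lemma Sys.M_mono {α D gs S τ} (h : Sys α D gs S τ) (hD : 2 ≤ D) : StrictMono (fun n => (n+1) * D ^ (S n).l) := by
  apply strictMono_nat_of_lt_succ
  intro n
  have h1 : D ^ (S n).l ≤ D ^ (S (n+1)).l := Nat.pow_le_pow_right (by omega) (h.step n).llt.le
  have h2 : 0 < D ^ (S (n+1)).l := by positivity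
  nlinarith

lemma Sys.generic {α D gs S τ} (h : Sys α D gs S τ) (hD : 2 ≤ D) (x : ℝ)
    (hx : ∀ l : ℕ, Int.fract (((D ^ l : ℕ) : ℝ) * x) ≤ 1/2) :
    IsGenericPt τ.toEquiv volume (torusProj (x, 0)) := by
  unfold IsGenericPt
  apply dense_tendsto gs h.dense (fun N f => (N : ℝ)⁻¹ * ∑ i ∈ Finset.range N, f (τ.toEquiv^[i] (torusProj (x, 0))))
    (fun f => ∫ z, f z)
  · intro N f g
    have := avg_lip N (fun i => τ.toEquiv^[i] (torusProj (x, 0))) f g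
    have := norm_nonneg (f - g)
    linarith
  · intro f g
    have := int_lip f g
    have := norm_nonneg (f - g)
    linarith
  intro j
  set f := fun p => gs j (torusProj p) with hf
  have hI : ∫ z, gs j z = I2 f := torus_int _ (gs j).continuous
  have hsum : ∀ N, ∑ i ∈ Finset.range N, gs j (τ.toEquiv^[i] (torusProj (x, 0))) =
      ∑ i ∈ Finset.range N, f (τ.lift^[i] (x, 0)) := by
    intro N; apply Finset.sum_congr rfl; intro i _; rw [lift_iter]
  simp only [hI, hsum]
  rw [Metric.tendsto_atTop]
  intro ε hε
  obtain ⟨δ, hδ, hu⟩ := Metric.uniformContinuous_iff.1 (cm_uc (gs j)) (ε/4) (by linarith)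
  have hC : Tendsto (fun n : ℕ => 2 * ‖gs j‖ * (1 / ((n:ℝ) + 1))) atTop (𝓝 0) := by
    simpa using tendsto_one_div_add_atTop_nhds_zero_nat.const_mul (2 * ‖gs j‖)
  obtain ⟨n2, hn2⟩ := eventually_atTop.1 ((((half_tendsto 2).eventually_lt_const hδ).and
    ((h.e_tendsto j).eventually_lt_const (show 0 < ε/4 by linarith))).and
    (((half_tendsto 2).eventually_lt_const (show 0 < ε/4 by linarith)).and
    (hC.eventually_lt_const (show 0 < ε/4 by linarith))))
  refine ⟨(max n2 (j+1) + 1) * D ^ (S (max n2 (j+1))).l, ?_⟩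
  intro N hN
  obtain ⟨n, hn, hN1, hN2⟩ := sandwich_n _ (h.M_mono hD) _ N hN
  have hn' : n2 ≤ n := (le_max_left _ _).trans hn
  have hjn : j < n := lt_of_lt_of_le (Nat.lt_succ_self j) ((le_max_right _ _).trans hn)
  obtain ⟨⟨-, b2⟩, b3, b4⟩ := hn2 n hn'
  have b1 := (hn2 (n+1) (by omega)).1.1
  have hb := (h.step n).e3b j hjn x (hx _) N
  have hq : 0 < D ^ (S n).l := by positivity
  have hNpos : 0 < N := lt_of_lt_of_le (by positivity) hN1
  have hNr : (0:ℝ) < N := by exact_mod_cast hNpos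
  have hcl : |∑ i ∈ Finset.range N, f (τ.lift^[i] (x, 0)) -
      ∑ i ∈ Finset.range N, f ((S (n+1)).H (x + i * (S (n+1)).a, 0))| ≤ N * (ε/4) := by
    rw [← Finset.sum_sub_distrib]
    refine (Finset.abs_sum_le_sum_abs _ _).trans ((Finset.sum_le_card_nsmul _ _ (ε/4) ?_).trans (by simp))
    intro i hi
    have h1 := h.cl (n+1) i ((Finset.mem_range.1 hi).le.trans hN2) (x, 0)
    rw [St.iter _ (h.val (n+1)).good, h.fixed x hx] at h1
    exact (hu (h1.trans_lt b1)).le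
  have hqN : 2 * ‖gs j‖ * ((D ^ (S n).l : ℕ):ℝ) ≤ N * (ε/4) := by
    have : ((D ^ (S n).l : ℕ):ℝ) ≤ N * (1 / ((n:ℝ) + 1)) := by
      rw [mul_one_div, le_div_iff₀ (by positivity), mul_comm]
      exact_mod_cast hN1
    calc 2 * ‖gs j‖ * ((D ^ (S n).l : ℕ):ℝ) ≤ 2 * ‖gs j‖ * (N * (1 / ((n:ℝ) + 1))) := by gcongr
      _ = N * (2 * ‖gs j‖ * (1 / ((n:ℝ) + 1))) := by ring
      _ ≤ _ := by gcongr
  rw [Real.dist_eq]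
  have e1 : (N:ℝ)⁻¹ * ∑ i ∈ Finset.range N, f (τ.lift^[i] (x, 0)) - I2 f =
    (N:ℝ)⁻¹ * (∑ i ∈ Finset.range N, f (τ.lift^[i] (x, 0)) - N * I2 f) := by field_simp
  rw [e1, abs_mul, abs_of_pos (inv_pos.2 hNr), inv_mul_lt_iff₀ hNr]
  have h5 : (N:ℝ) * (|Jf (S n).H f 0 - I2 f| + 2 * (1/2) ^ n) < N * (ε/4 + ε/4) := by
    apply mul_lt_mul_of_pos_left _ hNr
    linarith
  have h6 := abs_sub_le (∑ i ∈ Finset.range N, f (τ.lift^[i] (x, 0)))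
    (∑ i ∈ Finset.range N, f ((S (n+1)).H (x + i * (S (n+1)).a, 0))) (N * I2 f)
  have : |∑ i ∈ Finset.range N, f ((S (n+1)).H (x + i * (S (n+1)).a, 0)) - N * I2 f| ≤ _ := hb
  nlinarith

end Part11

open MeasureTheory Filter Topology
open scoped ENNReal
section Part12
set_option linter.unusedVariables false
set_option linter.unusedSimpArgs false

def dg (E : ℕ) (k : ℕ) (t : ℝ) : ℤ := ⌊(E:ℝ) * Int.fract ((E:ℝ) ^ k * t)⌋

lemma dg_nonneg (E k : ℕ) (t : ℝ) : 0 ≤ dg E k t :=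
  Int.floor_nonneg.2 (mul_nonneg (Nat.cast_nonneg _) (Int.fract_nonneg _))

lemma dg_le (E : ℕ) (hE : 0 < E) (k : ℕ) (t : ℝ) : (dg E k t : ℝ) ≤ E - 1 := by
  have hE' : (0:ℝ) < E := by exact_mod_cast hE
  have h : (E:ℝ) * Int.fract ((E:ℝ) ^ k * t) < ((E:ℤ):ℝ) := by
    have := Int.fract_lt_one ((E:ℝ) ^ k * t)
    push_cast; nlinarith
  have h2 : dg E k t < E := Int.floor_lt.2 h
  have h3 : dg E k t ≤ E - 1 := by omega
  exact_mod_cast h3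

lemma dg_succ (E k : ℕ) (t : ℝ) : dg E k (Int.fract ((E:ℝ) * t)) = dg E (k+1) t := by
  unfold dg
  congr 2
  have : (E:ℝ) ^ k * Int.fract ((E:ℝ) * t) = (E:ℝ)^(k+1) * t - ((E^k * ⌊(E:ℝ) * t⌋ : ℤ) : ℝ) := by
    rw [Int.fract]; push_cast; ring
  rw [this, Int.fract_sub_intCast]

/-- the coding map -/
def gm (E : ℕ) (t : ℝ) : ℝ := ∑' k, (dg E k t : ℝ) * (1 / (2 * E)) ^ (k+1)

lemma gm_geo (E : ℕ) (hE : 2 ≤ E) : HasSum (fun k : ℕ => ((E:ℝ) - 1) * (1 / (2 * E)) ^ (k+1)) (((E:ℝ) - 1) / (2 * E - 1)) := by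
  have hE' : (2:ℝ) ≤ E := by exact_mod_cast hE
  have h := (hasSum_geometric_of_lt_one (r := 1 / (2 * (E:ℝ))) (by positivity) (by
    rw [div_lt_one (by positivity)]; linarith)).mul_left (((E:ℝ) - 1) * (1 / (2 * E)))
  have h4 : ((E:ℝ) - 1) / (2 * E - 1) = ((E:ℝ) - 1) * (1 / (2 * E)) * (1 - 1 / (2 * (E:ℝ)))⁻¹ := by
    have : 2 * (E:ℝ) - 1 ≠ 0 := by linarith
    have h3 : 1 - 1 / (2 * (E:ℝ)) = (2 * E - 1) / (2 * E) := by field_simp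
    rw [h3]; field_simp
  rw [h4]
  have h5 : (fun k : ℕ => ((E:ℝ) - 1) * (1 / (2 * E)) ^ (k+1)) = fun k : ℕ => ((E:ℝ) - 1) * (1 / (2 * E)) * (1 / (2 * E)) ^ k := by
    funext k; rw [pow_succ]; ring
  rw [h5]; exact h

lemma gm_summable (E : ℕ) (hE : 2 ≤ E) (t : ℝ) : Summable (fun k => (dg E k t : ℝ) * (1 / (2 * E)) ^ (k+1)) := by
  refine Summable.of_nonneg_of_le (fun k => ?_) (fun k => ?_) (gm_geo E hE).summable
  · have := dg_nonneg E k t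
    have : (0:ℝ) ≤ dg E k t := by exact_mod_cast this
    positivity
  · have := dg_le E (by omega) k t
    gcongr

lemma gm_nonneg (E : ℕ) (t : ℝ) : 0 ≤ gm E t := by
  refine tsum_nonneg fun k => ?_
  have := dg_nonneg E k t
  have : (0:ℝ) ≤ dg E k t := by exact_mod_cast this
  positivity

lemma gm_le (E : ℕ) (hE : 2 ≤ E) (t : ℝ) : gm E t ≤ 1/2 := by
  have hE' : (2:ℝ) ≤ E := by exact_mod_cast hE
  have h := (gm_summable E hE t).tsum_le_tsum (fun k => ?_) (gm_geo E hE).summable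
  · rw [(gm_geo E hE).tsum_eq] at h
    refine h.trans ?_
    rw [div_le_div_iff₀ (by linarith) (by norm_num)]; linarith
  · have := dg_le E (by omega) k t
    gcongr

lemma gm_eq (E : ℕ) (hE : 2 ≤ E) (t : ℝ) : (2 * E : ℝ) * gm E t = dg E 0 t + gm E (Int.fract ((E:ℝ) * t)) := by
  have hE' : (2:ℝ) ≤ E := by exact_mod_cast hE
  have h1 := (gm_summable E hE t).tsum_eq_zero_add
  rw [gm, h1, gm, mul_add, ← tsum_mul_left]
  have hne : (2 * (E:ℝ)) * (1 / (2 * E)) = 1 := by field_simp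
  congr 1
  · rw [zero_add, pow_one, mul_left_comm, hne, mul_one]
  · apply tsum_congr; intro k
    rw [dg_succ, pow_succ _ (k+1)]
    linear_combination (dg E (k+1) t : ℝ) * (1 / (2 * (E:ℝ))) ^ (k+1) * hne

lemma gm_mem (E : ℕ) (hE : 2 ≤ E) (l : ℕ) : ∀ t, Int.fract ((((2 * E) ^ l : ℕ) : ℝ) * gm E t) ≤ 1/2 := by
  induction l with
  | zero =>
    intro t
    have := gm_le E hE t
    rw [pow_zero, Nat.cast_one, one_mul, Int.fract_eq_self.2 ⟨gm_nonneg E t, by linarith⟩]; exact this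
  | succ l ih =>
    intro t
    have h : (((2 * E) ^ (l+1) : ℕ) : ℝ) * gm E t =
      (((2 * E) ^ l : ℕ) : ℝ) * gm E (Int.fract ((E:ℝ) * t)) + (((2*E)^l * dg E 0 t : ℤ) : ℝ) := by
      have := gm_eq E hE t
      push_cast
      rw [pow_succ, mul_assoc, this]; ring
    rw [h, Int.fract_add_intCast]
    exact ih _

lemma gm_sep (E : ℕ) (hE : 2 ≤ E) (l : ℕ) : ∀ t t' : ℝ, 0 ≤ t → t < 1 → 0 ≤ t' → t' < 1 →
    |gm E t - gm E t'| < (1/2) * (1 / (2 * E)) ^ l → |t - t'| ≤ (1 / (E:ℝ)) ^ l := by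
  have hE' : (2:ℝ) ≤ E := by exact_mod_cast hE
  induction l with
  | zero =>
    intro t t' h1 h2 h3 h4 _
    rw [pow_zero, abs_le]; constructor <;> linarith
  | succ l ih =>
    intro t t' h1 h2 h3 h4 h
    have e1 := gm_eq E hE t
    have e2 := gm_eq E hE t'
    set s := Int.fract ((E:ℝ) * t) with hs
    set s' := Int.fract ((E:ℝ) * t') with hs'
    have b1 := gm_nonneg E s
    have b2 := gm_le E hE s
    have b3 := gm_nonneg E s'
    have b4 := gm_le E hE s'
    have hh : |2 * (E:ℝ) * gm E t - 2 * E * gm E t'| < (1/2) * (1 / (2 * E)) ^ l := by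
      rw [← mul_sub, abs_mul, abs_of_pos (by positivity)]
      calc 2 * (E:ℝ) * |gm E t - gm E t'| < 2 * E * ((1/2) * (1 / (2 * E)) ^ (l+1)) :=
            mul_lt_mul_of_pos_left h (by positivity)
        _ = _ := by rw [pow_succ]; field_simp
    have hle : (1 / (2 * (E:ℝ))) ^ l ≤ 1 := by
      apply pow_le_one₀ (by positivity)
      rw [div_le_one (by positivity)]; linarith
    have hd : dg E 0 t = dg E 0 t' := by
      have : |(dg E 0 t : ℝ) - dg E 0 t'| < 1 := by
        rw [e1, e2, abs_lt] at hh
        rw [abs_lt]; constructor <;> linarith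
      have h5 : |dg E 0 t - dg E 0 t'| < 1 := by exact_mod_cast this
      have := Int.abs_lt_one_iff.1 h5
      omega
    have hst := ih s s' (Int.fract_nonneg _) (Int.fract_lt_one _) (Int.fract_nonneg _) (Int.fract_lt_one _) (by
      rw [e1, e2, hd] at hh
      rwa [add_sub_add_left_eq_sub] at hh)
    have d1 : ∀ t : ℝ, 0 ≤ t → t < 1 → (E:ℝ) * t = dg E 0 t + Int.fract ((E:ℝ) * t) := by
      intro t h1 h2
      rw [dg, pow_zero, one_mul, Int.fract_eq_self.2 ⟨h1, h2⟩, Int.floor_add_fract]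
    have d2 := d1 t h1 h2
    have d3 := d1 t' h3 h4
    have : (E:ℝ) * (t - t') = s - s' := by rw [mul_sub, d2, d3, hd]; ring
    have h6 : (E:ℝ) * |t - t'| = |s - s'| := by
      rw [← this, abs_mul, abs_of_pos (show (0:ℝ) < E by linarith)]
    rw [pow_succ, mul_one_div, le_div_iff₀ (by positivity), mul_comm, h6]
    exact hst

lemma gm_holder (E : ℕ) (hE : 2 ≤ E) (r : ℝ) (hr : 0 < r) (hrE : ((2 * E : ℝ)) ^ r = E) (t t' : ℝ) (h1 : 0 ≤ t) (h2 : t < 1)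
    (h3 : 0 ≤ t') (h4 : t' < 1) : |t - t'| ≤ (4 * E) ^ r * |gm E t - gm E t'| ^ r := by
  have hE' : (2:ℝ) ≤ E := by exact_mod_cast hE
  set δ := |gm E t - gm E t'| with hδ
  have hd0 : 0 ≤ δ := abs_nonneg _
  have hl1 : 1 / (2 * (E:ℝ)) < 1 := by rw [div_lt_one (by positivity)]; linarith
  rw [← Real.mul_rpow (by positivity) hd0]
  rcases hd0.eq_or_lt with hz | hpos
  · have : ∀ l, |t - t'| ≤ (1 / (E:ℝ)) ^ l := fun l => gm_sep E hE l t t' h1 h2 h3 h4 (by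
      rw [← hδ, ← hz]; positivity)
    have hle : |t - t'| ≤ 0 := ge_of_tendsto' (tendsto_pow_atTop_nhds_zero_of_lt_one (by positivity)
      (by rw [div_lt_one (by positivity)]; linarith)) this
    exact hle.trans (by positivity)
  · classical
    have hex : ∃ l : ℕ, (1 / (2 * (E:ℝ))) ^ l ≤ 2 * δ :=
      ((tendsto_pow_atTop_nhds_zero_of_lt_one (by positivity) hl1).eventually_le_const (by positivity)).exists
    have hsp := Nat.find_spec hex
    rcases hfind : Nat.find hex with _ | l
    · rw [hfind, pow_zero] at hsp
      have : |t - t'| ≤ 1 := by rw [abs_le]; constructor <;> linarith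
      refine this.trans (Real.one_le_rpow ?_ hr.le)
      nlinarith
    · have hm := Nat.find_min hex (m := l) (by omega)
      rw [hfind] at hsp
      have := gm_sep E hE l t t' h1 h2 h3 h4 (by rw [← hδ]; linarith)
      refine this.trans ?_
      have e : (1 / (E:ℝ)) ^ l = ((1 / (2 * (E:ℝ))) ^ l) ^ r := by
        conv_lhs => rw [← hrE]
        rw [← Real.rpow_natCast, ← Real.rpow_natCast, ← Real.rpow_mul (by positivity), mul_comm (l:ℝ) r,
          Real.rpow_mul (by positivity), Real.div_rpow zero_le_one (by positivity : (0:ℝ) ≤ 2 * E) r, Real.one_rpow]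
      rw [e]
      apply Real.rpow_le_rpow (by positivity) _ hr.le
      have : (1 / (2 * (E:ℝ))) ^ l = (2 * E) * (1 / (2 * (E:ℝ))) ^ (l+1) := by rw [pow_succ]; field_simp
      rw [this]
      nlinarith

lemma gm_dim (E : ℕ) (hE : 2 ≤ E) (r : ℝ) (hr : 0 < r) (hrE : ((2 * E : ℝ)) ^ r = E) :
    ENNReal.ofReal r ≤ dimH ((fun t => torusProj (gm E t, 0)) '' Set.Ico 0 1) := by
  have hdist : ∀ t t', dist (torusProj (gm E t, 0)) (torusProj (gm E t', 0)) = |gm E t - gm E t'| := by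
    intro t t'
    rw [Prod.dist_eq]
    simp only [torusProj, dist_self]
    rw [max_eq_left dist_nonneg, dist_eq_norm, ← AddCircle.coe_sub, AddCircle.norm_coe_eq_abs_iff 1 one_ne_zero]
    have a1 := gm_nonneg E t
    have a2 := gm_le E hE t
    have a3 := gm_nonneg E t'
    have a4 := gm_le E hE t'
    rw [abs_le]; simp only [abs_one]; constructor <;> linarith
  set γ := fun t => torusProj (gm E t, 0) with hγ
  have hinj : Set.InjOn γ (Set.Ico 0 1) := by
    intro t ht t' ht' h
    have h1 := gm_holder E hE r hr hrE t t' ht.1 ht.2 ht'.1 ht'.2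
    have h2 := hdist t t'
    have h3 : dist (γ t) (γ t') = 0 := by rw [h, dist_self]
    rw [← h2, h3, Real.zero_rpow hr.ne', mul_zero] at h1
    have := abs_eq_zero.1 (le_antisymm h1 (abs_nonneg _))
    linarith
  have hinv : ∀ t ∈ Set.Ico (0:ℝ) 1, Function.invFunOn γ (Set.Ico 0 1) (γ t) = t := fun t ht =>
    hinj.leftInvOn_invFunOn ht
  have hh : HolderOnWith (Real.toNNReal ((4 * E) ^ r)) (Real.toNNReal r) (Function.invFunOn γ (Set.Ico 0 1)) (γ '' Set.Ico 0 1) := by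
    rintro _ ⟨t, ht, rfl⟩ _ ⟨t', ht', rfl⟩
    rw [hinv t ht, hinv t' ht', edist_dist, edist_dist, Real.dist_eq]
    have h1 := gm_holder E hE r hr hrE t t' ht.1 ht.2 ht'.1 ht'.2
    rw [← hdist] at h1
    rw [Real.coe_toNNReal r hr.le, ENNReal.ofReal_rpow_of_nonneg dist_nonneg hr.le]
    change _ ≤ ENNReal.ofReal _ * _
    rw [← ENNReal.ofReal_mul (by positivity)]
    exact ENNReal.ofReal_le_ofReal h1
  have h1 := hh.dimH_image_le (by simpa using hr)
  have himg : Function.invFunOn γ (Set.Ico 0 1) '' (γ '' Set.Ico 0 1) = Set.Ico 0 1 := by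
    ext t; constructor
    · rintro ⟨_, ⟨t, ht, rfl⟩, rfl⟩; rw [hinv t ht]; exact ht
    · intro ht; exact ⟨_, ⟨t, ht, rfl⟩, hinv t ht⟩
  have hne : ((Real.toNNReal r : NNReal) : ℝ≥0∞) ≠ 0 := by simpa using hr
  rw [himg, Real.dimH_of_nonempty_interior (by rw [interior_Ico]; exact Set.nonempty_Ioo.2 one_pos),
    ENNReal.le_div_iff_mul_le (Or.inl hne) (Or.inl ENNReal.coe_ne_top), Module.finrank_self, Nat.cast_one, one_mul] at h1
  exact h1

lemma exists_E (α : ℝ) (h1 : 1 < α) (h2 : α < 2) : ∃ E : ℕ, 2 ≤ E ∧ ∃ r : ℝ, 0 < r ∧ α - 1 ≤ r ∧ (2 * E : ℝ) ^ r = E := by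
  have ht : Tendsto (fun E : ℕ => Real.log E) atTop atTop := Real.tendsto_log_atTop.comp tendsto_natCast_atTop_atTop
  obtain ⟨E, hE1, hE2⟩ := ((ht.eventually_ge_atTop ((α - 1) * Real.log 2 / (2 - α))).and (eventually_ge_atTop 2)).exists
  have hE' : (2:ℝ) ≤ E := by exact_mod_cast hE2
  have hl : 0 < Real.log E := Real.log_pos (by linarith)
  have hl2 : 0 < Real.log 2 := Real.log_pos (by norm_num)
  have hm : Real.log (2 * E) = Real.log 2 + Real.log E := Real.log_mul (by norm_num) (by positivity)
  refine ⟨E, hE2, Real.log E / Real.log (2 * E), ?_, ?_, ?_⟩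
  · rw [hm]; positivity
  · rw [hm, le_div_iff₀ (by positivity)]
    rw [div_le_iff₀ (by linarith)] at hE1
    nlinarith
  · rw [Real.rpow_def_of_pos (by positivity), mul_div_cancel₀ _ (by rw [hm]; positivity), Real.exp_log (by positivity)]

lemma Sys.lower {α E gs S τ} (h : Sys α (2 * E) gs S τ) (hE : 2 ≤ E) (r : ℝ) (hr : 0 < r) (hαr : α - 1 ≤ r)
    (hrE : (2 * E : ℝ) ^ r = E) :
    ENNReal.ofReal (α - 1) ≤ dimH {x : Torus2 | IsGenericPt τ.toEquiv volume x} := by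
  refine (ENNReal.ofReal_le_ofReal hαr).trans ((gm_dim E hE r hr hrE).trans (dimH_mono ?_))
  rintro _ ⟨t, ht, rfl⟩
  exact h.generic (by omega) _ (fun l => gm_mem E hE l t)

end Part12

open MeasureTheory Filter Topology
open scoped ENNReal
section Part13
set_option linter.unusedVariables false
set_option linter.unusedSimpArgs false

lemma Jf_lip (H : ℝ × ℝ → ℝ × ℝ) (hH : Continuous H) (f g : C(Torus2, ℝ)) (y : ℝ) :
    |Jf H (fun p => f (torusProj p)) y - Jf H (fun p => g (torusProj p)) y| ≤ ‖f - g‖ := by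
  unfold Jf
  have c : ∀ f : C(Torus2, ℝ), Continuous (fun x : ℝ => f (torusProj (H (x, y)))) := fun f =>
    (cm_cont f).comp (hH.comp (by fun_prop))
  rw [← intervalIntegral.integral_sub ((c f).intervalIntegrable _ _) ((c g).intervalIntegrable _ _)]
  have := intervalIntegral.norm_integral_le_of_norm_le_const (a := 0) (b := 1) (C := ‖f - g‖)
    (f := fun x => f (torusProj (H (x, y))) - g (torusProj (H (x, y))))
    (fun x _ => (f - g).norm_coe_le_norm (torusProj (H (x, y))))
  simpa using this

lemma Sys.avg_tendsto {α D gs S τ} (h : Sys α D gs S τ) (hD : 2 ≤ D) (p : ℝ × ℝ) (f : C(Torus2, ℝ)) :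
    Tendsto (fun m => ((D ^ (S m).l : ℕ):ℝ)⁻¹ * ∑ i ∈ Finset.range (D ^ (S m).l), f (τ.toEquiv^[i] (torusProj p))
      - Jf (S m).H (fun p => f (torusProj p)) ((S m).K p).2) atTop (𝓝 0) := by
  apply dense_tendsto gs h.dense (fun m f => ((D ^ (S m).l : ℕ):ℝ)⁻¹ * ∑ i ∈ Finset.range (D ^ (S m).l), f (τ.toEquiv^[i] (torusProj p))
      - Jf (S m).H (fun p => f (torusProj p)) ((S m).K p).2) (fun _ => 0)
  · intro m f g
    have h1 := avg_lip (D ^ (S m).l) (fun i => τ.toEquiv^[i] (torusProj p)) f g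
    have h2 := Jf_lip (S m).H (h.val m).good.cd.continuous f g ((S m).K p).2
    rw [abs_le] at *
    constructor <;> linarith
  · intro f g; simp
  intro j
  rw [Metric.tendsto_atTop]
  intro ε hε
  obtain ⟨δ, hδ, hu⟩ := Metric.uniformContinuous_iff.1 (cm_uc (gs j)) (ε/2) (by linarith)
  obtain ⟨n2, hn2⟩ := eventually_atTop.1 (((half_tendsto 2).eventually_lt_const hδ).and
    ((half_tendsto 1).eventually_lt_const (show 0 < ε/2 by linarith)))
  refine ⟨max n2 (j+1), fun m hm => ?_⟩
  obtain ⟨b1, b2⟩ := hn2 m ((le_max_left _ _).trans hm)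
  have hjm : j < m := lt_of_lt_of_le (Nat.lt_succ_self j) ((le_max_right _ _).trans hm)
  have hv := h.val m
  have hq : 0 < D ^ (S m).l := by positivity
  set q := D ^ (S m).l with hqdef
  have hqr : (0:ℝ) < q := by exact_mod_cast hq
  have ha := hv.avg j hjm ((S m).K p).1 ((S m).K p).2
  obtain ⟨a, ha1, ha2⟩ := hv.cop
  have hper : ∀ t : ℝ, gs j (torusProj ((S m).H (((S m).K p).1 + (t + 1), ((S m).K p).2))) =
      gs j (torusProj ((S m).H (((S m).K p).1 + t, ((S m).K p).2))) := by
    intro t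
    rw [← add_assoc]
    exact ((cm_biper (gs j)).comp_eqv hv.good.eqv).fst _ _
  have hp := sum_perm q hq a (by exact_mod_cast ha2) (fun t => gs j (torusProj ((S m).H (((S m).K p).1 + t, ((S m).K p).2)))) hper
  simp only [← hqdef] at ha ha1
  rw [← hp, ← ha1] at ha
  have hcl : |∑ i ∈ Finset.range q, gs j (τ.toEquiv^[i] (torusProj p)) -
      ∑ i ∈ Finset.range q, gs j (torusProj ((S m).H (((S m).K p).1 + i * (S m).a, ((S m).K p).2)))| ≤ q * (ε/2) := by
    rw [← Finset.sum_sub_distrib]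
    refine (Finset.abs_sum_le_sum_abs _ _).trans ((Finset.sum_le_card_nsmul _ _ (ε/2) ?_).trans (by simp))
    intro i hi
    have hle : i ≤ (m+1) * D ^ (S m).l := by
      rw [← hqdef]; have := Finset.mem_range.1 hi; nlinarith
    have h1 := h.cl m i hle p
    rw [St.iter _ hv.good] at h1
    rw [lift_iter]
    exact (hu (h1.trans_lt b1)).le
  have hcl2 : |(q:ℝ)⁻¹ * ∑ i ∈ Finset.range q, gs j (τ.toEquiv^[i] (torusProj p)) -
      (q:ℝ)⁻¹ * ∑ i ∈ Finset.range q, gs j (torusProj ((S m).H (((S m).K p).1 + i * (S m).a, ((S m).K p).2)))| ≤ ε/2 := by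
    rw [← mul_sub, abs_mul, abs_of_pos (inv_pos.2 hqr), inv_mul_le_iff₀ hqr]
    exact hcl
  rw [Real.dist_eq, sub_zero]
  rw [one_mul] at b2
  rw [abs_le] at ha hcl2
  rw [abs_lt]
  constructor <;> linarith

lemma Sys.J_tendsto {α D gs S τ} (h : Sys α D gs S τ) (hD : 2 ≤ D) (p : ℝ × ℝ)
    (hp : IsGenericPt τ.toEquiv volume (torusProj p)) (f : C(Torus2, ℝ)) :
    Tendsto (fun m => Jf (S m).H (fun p => f (torusProj p)) ((S m).K p).2) atTop (𝓝 (∫ z, f z)) := by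
  have hl : StrictMono (fun m => (S m).l) := strictMono_nat_of_lt_succ fun n => (h.step n).llt
  have hq : Tendsto (fun m => D ^ (S m).l) atTop atTop :=
    (tendsto_pow_atTop_atTop_of_one_lt (by omega)).comp hl.tendsto_atTop
  have := ((hp f).comp hq).sub (h.avg_tendsto hD p f)
  simpa using this

lemma cos_mean (c : ℝ) : ∫ y in (0:ℝ)..1, Real.cos (2 * Real.pi * (y - c)) = 0 := by
  have hd : ∀ y ∈ Set.uIcc (0:ℝ) 1, HasDerivAt (fun y => Real.sin (2 * Real.pi * (y - c)) / (2 * Real.pi))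
      (Real.cos (2 * Real.pi * (y - c))) y := by
    intro y _
    have h1 : HasDerivAt (fun y => 2 * Real.pi * (y - c)) (2 * Real.pi) y := by
      simpa using ((hasDerivAt_id y).sub_const c).const_mul (2 * Real.pi)
    have := h1.sin.div_const (2 * Real.pi)
    rwa [mul_div_cancel_right₀ _ (by positivity)] at this
  rw [intervalIntegral.integral_eq_sub_of_hasDerivAt hd (Continuous.intervalIntegrable (by fun_prop) _ _)]
  rw [show 2 * Real.pi * (1 - c) = 2 * Real.pi * (0 - c) + 2 * Real.pi by ring, Real.sin_add_two_pi, sub_self]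

lemma cos_big (t : ℝ) (ht : |t| ≤ 1/16) : 1/2 ≤ Real.cos (2 * Real.pi * t) := by
  have h := Real.one_sub_sq_div_two_le_cos (x := 2 * Real.pi * t)
  have hpi := Real.pi_lt_four
  have hpi0 := Real.pi_pos
  have h2 : |2 * Real.pi * t| ≤ 1/2 := by
    rw [abs_mul, abs_of_pos (by positivity)]
    nlinarith [abs_nonneg t]
  have h3 := sq_le_sq' (abs_le.1 h2).1 (abs_le.1 h2).2
  nlinarith

/-- the observable detecting non genericity -/
lemma exists_obs {H K : ℝ × ℝ → ℝ × ℝ} (h : Good H K) (c : ℝ) : ∃ f : C(Torus2, ℝ),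
    (∫ z, f z) = 0 ∧ (∀ z, -1 ≤ f z) ∧ ∀ x y, |y - c| ≤ 1/16 → 1/2 ≤ f (torusProj (H (x, y))) := by
  have hb0 : Biper (fun p : ℝ × ℝ => Real.cos (2 * Real.pi * (p.2 - c))) := by
    intro p m
    have : 2 * Real.pi * ((p + ((m.1:ℝ), (m.2:ℝ))).2 - c) = 2 * Real.pi * (p.2 - c) + m.2 * (2 * Real.pi) := by
      simp only [Prod.snd_add]; ring
    simp only [this, Real.cos_add_int_mul_two_pi]
  have hb := hb0.comp_eqv h.eqvK
  have hc : Continuous (fun p => Real.cos (2 * Real.pi * ((K p).2 - c))) := by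
    have := h.cdK.continuous
    fun_prop
  refine ⟨⟨desc _, desc_cont hb hc⟩, ?_, ?_, ?_⟩
  · simp only [ContinuousMap.coe_mk]
    rw [torus_int _ (desc_cont hb hc)]
    simp only [desc_proj hb]
    rw [← h.pres _ hc hb]
    simp only [h.left]
    simp [I2, cos_mean]
  · intro z; obtain ⟨p, rfl⟩ := torusProj_oq.surjective z
    simp only [ContinuousMap.coe_mk]
    rw [desc_proj hb]; exact Real.neg_one_le_cos _
  · intro x y hy
    simp only [ContinuousMap.coe_mk]
    rw [desc_proj hb, h.left]
    exact cos_big _ hy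

lemma int_lower (φ : ℝ → ℝ) (hφ : Continuous φ) (U : Set ℝ) (hU : MeasurableSet U)
    (hv : volume (U ∩ Set.Icc 0 1) ≤ ENNReal.ofReal (1/8)) (h1 : ∀ x, -1 ≤ φ x) (h2 : ∀ x, x ∉ U → 1/2 ≤ φ x) :
    1/4 ≤ ∫ x in (0:ℝ)..1, φ x := by
  have hk : Integrable (fun _ : ℝ => (1/2:ℝ)) (volume.restrict (Set.Icc (0:ℝ) 1)) := integrable_const _
  have hi : Integrable (U.indicator (fun _ => (3/2:ℝ))) (volume.restrict (Set.Icc (0:ℝ) 1)) :=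
    (integrable_const _).indicator hU
  have hle : ∫ x in Set.Icc (0:ℝ) 1, (1/2 - U.indicator (fun _ => (3/2:ℝ)) x) ≤ ∫ x in Set.Icc (0:ℝ) 1, φ x := by
    apply setIntegral_mono_on
    · exact hk.sub hi
    · exact hφ.continuousOn.integrableOn_compact isCompact_Icc
    · exact measurableSet_Icc
    · intro x _
      by_cases hx : x ∈ U
      · rw [Set.indicator_of_mem hx]; linarith [h1 x]
      · rw [Set.indicator_of_notMem hx]; linarith [h2 x hx]
  rw [intervalIntegral.integral_of_le zero_le_one, ← integral_Icc_eq_integral_Ioc]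
  refine le_trans ?_ hle
  rw [integral_sub hk hi, setIntegral_indicator hU]
  simp only [integral_const, smul_eq_mul]
  have h3 : (volume.restrict (Set.Icc (0:ℝ) 1 ∩ U)).real Set.univ ≤ 1/8 := by
    rw [Measure.real, Measure.restrict_apply_univ, Set.inter_comm]
    exact ENNReal.toReal_le_of_le_ofReal (by norm_num) hv
  have h4 : (volume.restrict (Set.Icc (0:ℝ) 1)).real Set.univ = 1 := by
    rw [Measure.real, Measure.restrict_apply_univ]; simp
  rw [h4]; linarith

lemma union_small (Col : ℕ → Set ℝ) (k : ℕ) (h : ∀ n, volume (Col n ∩ Set.Icc 0 1) ≤ ENNReal.ofReal ((1/2) ^ (n + 4))) :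
    volume ((⋃ j, Col (k + j)) ∩ Set.Icc 0 1) ≤ ENNReal.ofReal (1/8) := by
  rw [Set.iUnion_inter]
  refine (measure_iUnion_le _).trans ?_
  have hs : HasSum (fun j : ℕ => (1/16:ℝ) * (1/2) ^ j) (1/8) := by
    have := hasSum_geometric_two.mul_left (1/16:ℝ)
    rwa [show (1/16:ℝ) * 2 = 1/8 by norm_num] at this
  rw [← hs.tsum_eq, ENNReal.ofReal_tsum_of_nonneg (fun _ => by positivity) hs.summable]
  refine ENNReal.tsum_le_tsum fun j => (h _).trans (ENNReal.ofReal_le_ofReal ?_)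
  have h1 : ((1:ℝ)/2) ^ k ≤ 1 := pow_le_one₀ (by norm_num) (by norm_num)
  have h2 : (0:ℝ) < (1/2) ^ j := by positivity
  rw [pow_add, pow_add]
  have h3 : ((1:ℝ)/2) ^ k * (1/2) ^ j ≤ 1 * (1/2) ^ j := by gcongr
  rw [show ((1:ℝ)/2)^4 = 1/16 by norm_num]
  linarith

end Part13

open MeasureTheory Filter Topology
open scoped ENNReal
section Part14
set_option linter.unusedVariables false
set_option linter.unusedSimpArgs false

lemma Sys.nongeneric {α D gs S τ} (hs : Sys α D gs S τ) (hD : 2 ≤ D) (h : ℕ → ℝ × ℝ → ℝ × ℝ) (Col : ℕ → Set ℝ)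
    (hmeas : ∀ n, MeasurableSet (Col n))
    (hvol : ∀ n, volume (Col n ∩ Set.Icc 0 1) ≤ ENNReal.ofReal ((1/2) ^ (n + 4)))
    (hH : ∀ n p, (S (n+1)).H p = (S n).H (h n p)) (hK : ∀ n p, h n ((S (n+1)).K p) = (S n).K p)
    (hc : ∀ n, ∀ x y : ℝ, (S (n+1)).w ≤ |y - round y| → (h n (x, y)).1 = x ∧
      (x ∉ Col n → |(h n (x, y)).2 - y| ≤ (S (n+1)).w / 4))
    (z : Torus2) (hz : IsGenericPt τ.toEquiv volume z) (n1 : ℕ)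
    (h1 : ∀ n, n1 ≤ n → z ∉ (fun p => torusProj ((S n).H p)) '' {p | p.1 ∈ Col n})
    (h2 : ∀ n, n1 ≤ n → z ∉ (fun p => torusProj ((S (n+1)).H p)) '' {p | |p.2 - round p.2| < (S (n+1)).w}) : False := by
  obtain ⟨p, rfl⟩ := torusProj_oq.surjective z
  have hr : ∀ n, n1 ≤ n → (S (n+1)).w ≤ |((S (n+1)).K p).2 - round ((S (n+1)).K p).2| := by
    intro n hn
    by_contra hcon
    exact h2 n hn ⟨(S (n+1)).K p, not_le.1 hcon, by simp only [(hs.val (n+1)).good.right]⟩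
  have hx : ∀ n, n1 ≤ n → ((S n).K p).1 ∉ Col n := by
    intro n hn hcon
    exact h1 n hn ⟨(S n).K p, hcon, by simp only [(hs.val n).good.right]⟩
  have hstep : ∀ n, n1 ≤ n → |((S n).K p).2 - ((S (n+1)).K p).2| ≤ (S (n+1)).w / 4 := by
    intro n hn
    have := hc n ((S (n+1)).K p).1 ((S (n+1)).K p).2 (hr n hn)
    rw [Prod.mk.eta, hK] at this
    exact this.2 (this.1 ▸ hx n hn)
  set k := n1 + 1 with hk
  set c := ((S k).K p).2 with hcdef
  set W := (S k).w with hW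
  have hW8 : W ≤ 1/8 := (hs.step n1).w8
  have hWpos : ∀ m, 0 < (S m).w := fun m => (hs.val m).wpos
  have hcW : W ≤ |c - round c| := hr n1 le_rfl
  have hwle : ∀ m, (S (m+1)).w ≤ (S m).w / 8 := fun m => (hs.step m).wle
  have hwW : ∀ d, (S (k+d)).w ≤ W := by
    intro d
    induction d with
    | zero => exact le_rfl
    | succ d ih => have := hwle (k+d); have := hWpos (k+d); rw [← add_assoc]; linarith
  have hcm : ∀ d, |((S (k+d)).K p).2 - c| ≤ (W - (S (k+d)).w) / 28 := by
    intro d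
    induction d with
    | zero => simp [hcdef, hW]
    | succ d ih =>
      have a1 := hwle (k+d)
      have a2 := hstep (k+d) (by omega)
      rw [← add_assoc]
      have a3 := abs_sub_le ((S (k+d+1)).K p).2 ((S (k+d)).K p).2 c
      rw [abs_sub_comm ((S (k+d+1)).K p).2 ((S (k+d)).K p).2] at a3
      linarith
  have hdown : ∀ d, ∀ x y : ℝ, (∀ j, x ∉ Col (k + j)) → |y - c| ≤ W/14 - (W - (S (k+d)).w) / 28 →
      ∃ y', (S (k+d)).H (x, y) = (S k).H (x, y') ∧ |y' - c| ≤ W/14 := by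
    intro d
    induction d with
    | zero =>
      intro x y _ hy
      refine ⟨y, rfl, ?_⟩
      simp only [add_zero, ← hW] at hy
      linarith
    | succ d ih =>
      intro x y hxc hy
      rw [← add_assoc] at hy
      have a1 := hwle (k+d)
      have a2 := hwW d
      have a4 := hWpos (k+d)
      have a5 := hWpos (k+d+1)
      have a3 : (S (k+d+1)).w ≤ |y - round y| := by
        have b1 : |c - round c| ≤ |c - round y| := round_le c (round y)
        have b2 := abs_sub_le c y (round y)
        rw [abs_sub_comm c y] at b2
        linarith
      obtain ⟨e1, e2⟩ := hc (k+d) x y a3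
      have e2 := e2 (hxc d)
      obtain ⟨y', hy1, hy2⟩ := ih x (h (k+d) (x, y)).2 hxc (by
        have b2 := abs_sub_le (h (k+d) (x, y)).2 y c
        linarith)
      refine ⟨y', ?_, hy2⟩
      rw [← add_assoc, hH, ← hy1]
      congr 1
      exact Prod.ext e1 rfl
  obtain ⟨f, hf0, hf1, hf2⟩ := exists_obs (hs.val k).good c
  have hJ := hs.J_tendsto hD p hz f
  rw [hf0] at hJ
  have hlow : ∀ d, 1/4 ≤ Jf (S (k+d)).H (fun p => f (torusProj p)) ((S (k+d)).K p).2 := by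
    intro d
    unfold Jf
    apply int_lower _ _ (⋃ j, Col (k+j)) (MeasurableSet.iUnion fun j => hmeas _) (union_small Col k hvol)
    · intro x; exact hf1 _
    · intro x hxU
      have hxc : ∀ j, x ∉ Col (k+j) := fun j hj => hxU (Set.mem_iUnion.2 ⟨j, hj⟩)
      have b1 := hcm d
      have b2 := hWpos (k+d)
      obtain ⟨y', e1, e2⟩ := hdown d x _ hxc (show |((S (k+d)).K p).2 - c| ≤ _ by linarith)
      rw [e1]
      apply hf2
      linarith
    · exact (cm_cont f).comp ((hs.val (k+d)).good.cd.continuous.comp (by fun_prop))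
  have hJ2 : Tendsto (fun d => Jf (S (k+d)).H (fun p => f (torusProj p)) ((S (k+d)).K p).2) atTop (𝓝 0) := by
    have := (tendsto_add_atTop_iff_nat k).2 hJ
    simpa only [add_comm] using this
  have := ge_of_tendsto' hJ2 hlow
  norm_num at this

lemma Sys.upper {α D gs S τ} (hs : Sys α D gs S τ) (hα1 : 1 < α) (hα2 : α < 2) (hD : 2 ≤ D) :
    dimH {x : Torus2 | IsGenericPt τ.toEquiv volume x} ≤ ENNReal.ofReal α ∧
      volume {x : Torus2 | IsGenericPt τ.toEquiv volume x} = 0 := by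
  choose h Col hmeas hvol hH hK hA1 hA2 hc using fun n => (hs.step n).geo
  set A1 : ℕ → Set Torus2 := fun n => (fun p => torusProj ((S n).H p)) '' {p | p.1 ∈ Col n} with hA1d
  set A2 : ℕ → Set Torus2 := fun n => (fun p => torusProj ((S (n+1)).H p)) '' {p | |p.2 - round p.2| < (S (n+1)).w} with hA2d
  set B1 : Set Torus2 := {z | ∀ n1, ∃ n, n1 ≤ n ∧ z ∈ A1 n} with hB1
  set B2 : Set Torus2 := {z | ∀ n1, ∃ n, n1 ≤ n ∧ z ∈ A2 n} with hB2
  have hsub : {x : Torus2 | IsGenericPt τ.toEquiv volume x} ⊆ B1 ∪ B2 := by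
    intro z hz
    by_contra hcon
    simp only [Set.mem_union, not_or] at hcon
    obtain ⟨c1, c2⟩ := hcon
    have c1 : ¬ ∀ n1, ∃ n, n1 ≤ n ∧ z ∈ A1 n := c1
    have c2 : ¬ ∀ n1, ∃ n, n1 ≤ n ∧ z ∈ A2 n := c2
    push Not at c1 c2
    obtain ⟨n1, c1⟩ := c1
    obtain ⟨n2, c2⟩ := c2
    exact hs.nongeneric hD h Col hmeas hvol hH hK hc z hz (max n1 n2)
      (fun n hn => c1 n ((le_max_left _ _).trans hn)) (fun n hn => c2 n ((le_max_right _ _).trans hn))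
  constructor
  · refine (dimH_mono hsub).trans ?_
    rw [dimH_union]
    exact max_le (limsup_small_haus α hα1 A1 hA1 B1 (fun z hz => hz)) (limsup_small_haus α hα1 A2 hA2 B2 (fun z hz => hz))
  · refine measure_mono_null hsub (measure_union_null ?_ ?_)
    · exact limsup_small_vol α hα1 hα2 A1 hA1 B1 (fun z hz => hz)
    · exact limsup_small_vol α hα1 hα2 A2 hA2 B2 (fun z hz => hz)

end Part14

/-- **Theorem D.** For any `1 < α < 2` there is a C^∞ μ-preserving diffeomorphism `T` of `𝕋²`
such that the set `B_α` of all generic points of `T` for the Lebesgue measure `μ` satisfies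
`α − 1 ≤ dim_H B_α ≤ α` and `μ(B_α) = 0`. -/
theorem generic_points_hausdorff_dim_interval (α : ℝ) (hα1 : 1 < α) (hα2 : α < 2) :
    ∃ T : SmoothMPTorusDiffeo,
      ENNReal.ofReal (α - 1) ≤ dimH {x : Torus2 | IsGenericPt T.toEquiv volume x} ∧
      dimH {x : Torus2 | IsGenericPt T.toEquiv volume x} ≤ ENNReal.ofReal α ∧
      volume {x : Torus2 | IsGenericPt T.toEquiv volume x} = 0 := by
  obtain ⟨E, hE, r, hr, hαr, hrE⟩ := exists_E α hα1 hα2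
  obtain ⟨gs, S, τ, hs⟩ := exists_sys α hα1 (2 * E) (by omega)
  exact ⟨τ, hs.lower hE r hr hαr hrE, hs.upper hα1 hα2 (by omega)⟩
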